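/- arXiv:2510.17743 — 2 statements merged into one kernel-verified Lean document; each statement's English description precedes it below -/
import Mathlib

section
/- For every C ∈ ℕ there exists K = K(C) such that the following holds. Let 𝓗 be a hypergraph on a finite vertex set V having polynomial tails with parameters N and C, and let m be a real number with K ≤ m ≤ N ≤ m³. Then there exists an m-good set S ⊆ V. -/
open Set

noncomputable section

/-- A hypergraph on vertex set `V` (a collection of edges, each a finite subset of `V`) has
polynomial tails with parameters `N, C ∈ ℕ` if every edge has at most `N` vertices and, for
every vertex `v` and `α ∈ (0,1]`, the number of edges `F` with `v ∈ F` and weight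
`w(F) = |F|/N ≥ α` is at most `C α^{-C}`. -/
def HasPolyTails {V : Type*} (H : Set (Finset V)) (N C : ℕ) : Prop :=
  (∀ F ∈ H, F.card ≤ N) ∧
  ∀ (v : V) (α : ℝ), 0 < α → α ≤ 1 →
    (({F | F ∈ H ∧ v ∈ F ∧ α ≤ (F.card : ℝ) / N}).ncard : ℝ) ≤ (C : ℝ) * α⁻¹ ^ C

/-- A set `S ⊆ V` is `m`-good for the hypergraph `H` with parameters `N, C`. -/
def IsGoodSet {V : Type*} (H : Set (Finset V)) (N C : ℕ) (m : ℝ) (S : Set V) : Prop :=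
  -- (1) concentration for heavy edges
  (∀ F ∈ H, m ^ (-(2 : ℝ)/3) < (F.card : ℝ) / N → (F.card : ℝ) / N ≤ 1 →
    (1 - m ^ (-(1 : ℝ)/12)) * m * ((F.card : ℝ) / N) ≤ ((S ∩ ↑F).ncard : ℝ) ∧
    ((S ∩ ↑F).ncard : ℝ) ≤ (1 + m ^ (-(1 : ℝ)/12)) * m * ((F.card : ℝ) / N)) ∧
  -- (2) upper bound for medium edges
  (∀ F ∈ H, m ^ (-(2 : ℝ)) < (F.card : ℝ) / N → (F.card : ℝ) / N ≤ m ^ (-(2 : ℝ)/3) →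
    ((S ∩ ↑F).ncard : ℝ) ≤ (1 + m ^ (-(1 : ℝ)/12)) * m ^ ((1 : ℝ)/3)) ∧
  -- (3) very few vertices in light edges
  (∀ F ∈ H, (F.card : ℝ) / N ≤ m ^ (-(2 : ℝ)) →
    (S ∩ ↑F).ncard ≤ 6 * C + 3)

section RandomSubset

open MeasureTheory ProbabilityTheory

/-- Inductive core of the symmetric Lovász local lemma: conditionally on avoiding the events
indexed by `T`, any further event has probability at most `2 * q`. -/
lemma measureReal_inter_iInter_compl_le {Ω ι : Type*} [MeasurableSpace Ω] [DecidableEq ι]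
    (μ : Measure Ω) [IsFiniteMeasure μ] (A : ι → Set Ω)
    (J : Finset ι) (r : ι → ι → Prop) [DecidableRel r] (q d : ℝ) (hq : 0 ≤ q)
    (hqd : 4 * (q * d) ≤ 1) (hd : ∀ i ∈ J, ((J.filter (r i)).card : ℝ) ≤ d)
    (hind : ∀ i ∈ J, ∀ T ⊆ J, (∀ j ∈ T, ¬ r i j) →
      μ.real (A i ∩ ⋂ j ∈ T, (A j)ᶜ) ≤ q * μ.real (⋂ j ∈ T, (A j)ᶜ))
    (T : Finset ι) (hT : T ⊆ J) (i : ι) (hi : i ∈ J) :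
    μ.real (A i ∩ ⋂ j ∈ T, (A j)ᶜ) ≤ 2 * q * μ.real (⋂ j ∈ T, (A j)ᶜ) := by
  induction T using Finset.strongInduction generalizing i with
  | H T ih =>
    set T₁ := T.filter (r i) with hT₁
    set T₂ := T.filter (fun j => ¬ r i j) with hT₂
    set B := ⋂ j ∈ T₂, (A j)ᶜ with hB
    have hT₂J : T₂ ⊆ J := (Finset.filter_subset _ _).trans hT
    have hsub : A i ∩ ⋂ j ∈ T, (A j)ᶜ ⊆ A i ∩ B :=
      inter_subset_inter_right _
        (biInter_subset_biInter_left fun j hj => Finset.filter_subset _ _ hj)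
    have h₁ : μ.real (A i ∩ ⋂ j ∈ T, (A j)ᶜ) ≤ q * μ.real B :=
      (measureReal_mono hsub).trans
        (hind i hi T₂ hT₂J fun j hj => (Finset.mem_filter.1 hj).2)
    have hcover : B ⊆ (⋂ j ∈ T, (A j)ᶜ) ∪ ⋃ j ∈ T₁, (A j ∩ B) := by
      intro ω hω
      by_cases h : ∃ j ∈ T₁, ω ∈ A j
      · obtain ⟨j, hj, hjω⟩ := h
        exact Or.inr (mem_biUnion (x := j) (by simpa using hj) ⟨hjω, hω⟩)
      · push Not at h
        refine Or.inl (mem_iInter₂.2 fun j hj => ?_)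
        by_cases hr : r i j
        · exact h j (Finset.mem_filter.2 ⟨hj, hr⟩)
        · exact mem_iInter₂.1 hω j (Finset.mem_filter.2 ⟨hj, hr⟩)
    have h₂ : ∀ j ∈ T₁, μ.real (A j ∩ B) ≤ 2 * q * μ.real B := by
      intro j hj
      have hj' := Finset.mem_filter.1 hj
      refine ih T₂ (Finset.filter_ssubset.2 ⟨j, hj'.1, by simpa using hj'.2⟩) hT₂J j (hT hj'.1)
    have hcard : (T₁.card : ℝ) ≤ d :=
      le_trans (by exact_mod_cast Finset.card_le_card (Finset.filter_subset_filter _ hT)) (hd i hi)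
    have h₃ : μ.real B ≤ μ.real (⋂ j ∈ T, (A j)ᶜ) + T₁.card * (2 * q * μ.real B) := by
      calc μ.real B ≤ μ.real ((⋂ j ∈ T, (A j)ᶜ) ∪ ⋃ j ∈ T₁, (A j ∩ B)) := measureReal_mono hcover
        _ ≤ μ.real (⋂ j ∈ T, (A j)ᶜ) + μ.real (⋃ j ∈ T₁, (A j ∩ B)) := measureReal_union_le _ _
        _ ≤ μ.real (⋂ j ∈ T, (A j)ᶜ) + ∑ j ∈ T₁, μ.real (A j ∩ B) := by
          gcongr; exact measureReal_biUnion_finset_le _ _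
        _ ≤ _ := by
          gcongr
          exact (Finset.sum_le_sum h₂).trans (by simp)
    have hB0 : 0 ≤ μ.real B := measureReal_nonneg
    have h₄ : (T₁.card : ℝ) * (2 * q * μ.real B) ≤ d * (2 * q * μ.real B) := by gcongr
    have h₅ : 4 * (q * d) * μ.real B ≤ 1 * μ.real B := by gcongr
    have h₆ : μ.real B ≤ 2 * μ.real (⋂ j ∈ T, (A j)ᶜ) := by linarith
    calc _ ≤ q * μ.real B := h₁
      _ ≤ q * (2 * μ.real (⋂ j ∈ T, (A j)ᶜ)) := by gcongr
      _ = _ := by ring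

/-- The symmetric Lovász local lemma for finitely many events. -/
theorem exists_forall_notMem_of_local {Ω ι : Type*} [MeasurableSpace Ω] [DecidableEq ι]
    (μ : Measure Ω) [IsProbabilityMeasure μ] (A : ι → Set Ω)
    (J : Finset ι) (r : ι → ι → Prop) [DecidableRel r] (q d : ℝ) (hq : 0 ≤ q) (hq₂ : 2 * q < 1)
    (hqd : 4 * (q * d) ≤ 1) (hd : ∀ i ∈ J, ((J.filter (r i)).card : ℝ) ≤ d)
    (hind : ∀ i ∈ J, ∀ T ⊆ J, (∀ j ∈ T, ¬ r i j) →
      μ.real (A i ∩ ⋂ j ∈ T, (A j)ᶜ) ≤ q * μ.real (⋂ j ∈ T, (A j)ᶜ)) :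
    ∃ ω, ∀ i ∈ J, ω ∉ A i := by
  have key : ∀ T ⊆ J, 0 < μ.real (⋂ j ∈ T, (A j)ᶜ) := by
    intro T
    induction T using Finset.induction with
    | empty => intro _; simp
    | insert i T _ ih =>
      intro hT
      rw [Finset.insert_subset_iff] at hT
      have h₀ := ih hT.2
      have h₁ := measureReal_inter_iInter_compl_le μ A J r q d hq hqd hd hind T hT.2 i hT.1
      have h₂ : μ.real (⋂ j ∈ T, (A j)ᶜ) ≤
          μ.real (A i ∩ ⋂ j ∈ T, (A j)ᶜ) + μ.real (⋂ j ∈ insert i T, (A j)ᶜ) := by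
        refine (measureReal_mono ?_).trans (measureReal_union_le _ _)
        intro ω hω
        by_cases h : ω ∈ A i
        · exact Or.inl ⟨h, hω⟩
        · refine Or.inr ?_
          rw [Finset.set_biInter_insert]
          exact ⟨h, hω⟩
      have h₃ := mul_lt_mul_of_pos_right hq₂ h₀
      linarith
  obtain ⟨ω, hω⟩ : (⋂ j ∈ J, (A j)ᶜ).Nonempty := by
    by_contra h
    rw [not_nonempty_iff_eq_empty] at h
    simpa [h] using key J subset_rfl
  exact ⟨ω, fun i hi => mem_iInter₂.1 hω i hi⟩

/-- Events determined by disjoint sets of coordinates are independent under a product measure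
on a finite cube. -/
lemma measureReal_pi_inter_of_dependsOn {V : Type*} [Fintype V] (ν : V → Measure Bool)
    [∀ v, IsProbabilityMeasure (ν v)] {A B : Set (V → Bool)} {F G : Finset V}
    (hFG : Disjoint F G) (hA : DependsOn (· ∈ A) (F : Set V)) (hB : DependsOn (· ∈ B) (G : Set V)) :
    (Measure.pi ν).real (A ∩ B) = (Measure.pi ν).real A * (Measure.pi ν).real B := by
  classical
  have preimage_eq : ∀ {E : Set (V → Bool)} {U : Finset V}, DependsOn (· ∈ E) (U : Set V) →
      (fun ω (i : U) => ω i) ⁻¹' ((fun ω (i : U) => ω i) '' E) = E := by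
    intro E U hE
    refine subset_antisymm ?_ (subset_preimage_image _ _)
    rintro ω ⟨ω', hω', h⟩
    exact (hE (x := ω') (y := ω) fun i hi => congrFun h ⟨i, hi⟩).mp hω'
  have hind : iIndepFun (fun v (ω : V → Bool) => ω v) (Measure.pi ν) :=
    iIndepFun_pi (X := fun _ b => b) fun _ => aemeasurable_id
  have h := (hind.indepFun_finset F G hFG fun v => measurable_pi_apply v).measure_inter_preimage_eq_mul
    ((fun ω (i : F) => ω i) '' A) ((fun ω (i : G) => ω i) '' B)
    (Set.toFinite _).measurableSet (Set.toFinite _).measurableSet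
  rw [preimage_eq hA, preimage_eq hB] at h
  simp only [measureReal_def, h, ENNReal.toReal_mul]

/-- The number of elements of `F` selected by `ω`. -/
def selectedCard {V : Type*} (F : Finset V) (ω : V → Bool) : ℕ := (F.filter (ω · = true)).card

lemma dependsOn_selectedCard {V : Type*} (F : Finset V) :
    DependsOn (selectedCard F) (F : Set V) := by
  intro ω ω' h
  unfold selectedCard
  congr 1
  exact Finset.filter_congr fun v hv => by rw [h v hv]

/-- The law of a random subset of `V` containing each element independently with
probability `p`. -/
abbrev randomSubset (V : Type*) [Fintype V] (p : unitInterval) : Measure (V → Bool) :=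
  Measure.pi fun _ => bernoulliMeasure true false p

lemma mgf_selectedCard_le {V : Type*} [Fintype V] (p : unitInterval) (F : Finset V) (t : ℝ) :
    mgf (fun ω => (selectedCard F ω : ℝ)) (randomSubset V p) t ≤
      Real.exp (F.card * p * (Real.exp t - 1)) := by
  let b : Bool → ℝ := fun x => if x = true then 1 else 0
  have hsum : (fun ω : V → Bool => (selectedCard F ω : ℝ)) = ∑ v ∈ F, fun ω => b (ω v) := by
    ext ω
    simp [selectedCard, b, Finset.sum_apply]
  have hind : iIndepFun (fun v (ω : V → Bool) => b (ω v)) (randomSubset V p) :=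
    iIndepFun_pi (X := fun _ => b) fun _ => (measurable_of_finite b).aemeasurable
  have hone : ∀ v : V, mgf (fun ω : V → Bool => b (ω v)) (randomSubset V p) t =
      p * Real.exp t + (1 - p) := by
    intro v
    have hm := measurePreserving_eval (fun _ : V => bernoulliMeasure true false p) v
    have h := mgf_map (μ := randomSubset V p) (X := b) (t := t) hm.measurable.aemeasurable
      (measurable_of_finite _).aestronglyMeasurable
    rw [hm.map_eq] at h
    have h' : mgf (b ∘ Function.eval v) (randomSubset V p) t = p * Real.exp t + (1 - p) := by
      rw [← h, mgf, integral_bernoulliMeasure]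
      simp [b]
    exact h'
  rw [hsum, hind.mgf_sum (fun v => (measurable_of_finite b).comp (measurable_pi_apply v)),
    Finset.prod_congr rfl fun v _ => hone v, Finset.prod_const, mul_assoc, Real.exp_nat_mul]
  have hp := p.2
  refine pow_le_pow_left₀ ?_ ?_ _
  · have := Real.exp_pos t
    have := mul_nonneg hp.1 this.le
    linarith [hp.2]
  · linarith [Real.add_one_le_exp ((p : ℝ) * (Real.exp t - 1))]

lemma measureReal_selectedCard_ge_le {V : Type*} [Fintype V] (p : unitInterval) (F : Finset V)
    {t : ℝ} (ht : 0 ≤ t) (a : ℝ) :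
    (randomSubset V p).real {ω | a ≤ selectedCard F ω} ≤
      Real.exp (F.card * p * (Real.exp t - 1) - t * a) := by
  refine (measure_ge_le_exp_mul_mgf a ht (Integrable.of_finite)).trans ?_
  rw [sub_eq_neg_add, Real.exp_add, ← neg_mul]
  gcongr
  exact mgf_selectedCard_le p F t

lemma measureReal_selectedCard_le_le {V : Type*} [Fintype V] (p : unitInterval) (F : Finset V)
    {t : ℝ} (ht : t ≤ 0) (a : ℝ) :
    (randomSubset V p).real {ω | selectedCard F ω ≤ a} ≤
      Real.exp (F.card * p * (Real.exp t - 1) - t * a) := by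
  refine (measure_le_le_exp_mul_mgf a ht (Integrable.of_finite)).trans ?_
  rw [sub_eq_neg_add, Real.exp_add, ← neg_mul]
  gcongr
  exact mgf_selectedCard_le p F t

/-- Chernoff bound for the upper tail, with an upper bound `M` on the mean. -/
lemma measureReal_selectedCard_ge_le_exp {V : Type*} [Fintype V] (p : unitInterval)
    (F : Finset V) {δ M : ℝ} (hδ : 0 ≤ δ) (hδ₁ : δ ≤ 1) (hM : (F.card : ℝ) * p ≤ M) :
    (randomSubset V p).real {ω | (1 + δ) * M ≤ selectedCard F ω} ≤
      Real.exp (-(M * δ ^ 2 / 4)) := by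
  refine (measureReal_selectedCard_ge_le p F (t := δ / 2) (by linarith) _).trans
    (Real.exp_le_exp.2 ?_)
  have hM₀ : 0 ≤ M := le_trans (mul_nonneg (Nat.cast_nonneg _) p.2.1) hM
  have h := (abs_le.1 (Real.abs_exp_sub_one_sub_id_le (x := δ / 2)
    (abs_le.2 ⟨by linarith, by linarith⟩))).2
  have h₀ := Real.add_one_le_exp (δ / 2)
  have h₁ : (F.card : ℝ) * p * (Real.exp (δ / 2) - 1) ≤ M * (Real.exp (δ / 2) - 1) :=
    mul_le_mul_of_nonneg_right hM (by linarith)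
  have h₂ := mul_le_mul_of_nonneg_left h hM₀
  nlinarith

/-- Chernoff bound for the lower tail. -/
lemma measureReal_selectedCard_le_le_exp {V : Type*} [Fintype V] (p : unitInterval)
    (F : Finset V) {δ : ℝ} (hδ : 0 ≤ δ) (hδ₁ : δ ≤ 1) :
    (randomSubset V p).real {ω | selectedCard F ω ≤ (1 - δ) * ((F.card : ℝ) * p)} ≤
      Real.exp (-(F.card * p * δ ^ 2 / 4)) := by
  refine (measureReal_selectedCard_le_le p F (t := -(δ / 2)) (by linarith) _).trans
    (Real.exp_le_exp.2 ?_)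
  have hM₀ : 0 ≤ F.card * (p : ℝ) := mul_nonneg (Nat.cast_nonneg _) p.2.1
  have h := (abs_le.1 (Real.abs_exp_sub_one_sub_id_le (x := -(δ / 2))
    (abs_le.2 ⟨by linarith, by linarith⟩))).2
  have h₂ := mul_le_mul_of_nonneg_left h hM₀
  nlinarith

/-- Local lemma for random subsets: if each edge `F` has an unlikely set of forbidden selected
counts and meets few other edges, some selection avoids all forbidden counts. -/
lemma exists_selectedCard_notMem {V : Type*} [Fintype V] [DecidableEq V] (p : unitInterval)
    (H : Finset (Finset V)) (bad : Finset V → Set ℕ) (q d : ℝ) (hq : 0 ≤ q) (hq₂ : 2 * q < 1)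
    (hqd : 4 * (q * d) ≤ 1)
    (hd : ∀ F ∈ H, ((H.filter fun G => ¬ Disjoint F G).card : ℝ) ≤ d)
    (hbad : ∀ F ∈ H, (randomSubset V p).real {ω | selectedCard F ω ∈ bad F} ≤ q) :
    ∃ ω : V → Bool, ∀ F ∈ H, selectedCard F ω ∉ bad F := by
  refine exists_forall_notMem_of_local (randomSubset V p)
    (fun F => {ω | selectedCard F ω ∈ bad F}) H
    (fun F G => ¬ Disjoint F G) q d hq hq₂ hqd hd ?_
  intro F hF T _ hT
  rw [measureReal_pi_inter_of_dependsOn (F := F) (G := Finset.univ \ F) _ Finset.disjoint_sdiff]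
  · exact mul_le_mul_of_nonneg_right (hbad F hF) measureReal_nonneg
  · intro ω ω' h
    simp only [mem_ofPred_eq, dependsOn_selectedCard F h]
  · intro ω ω' h
    simp only [mem_iInter, mem_compl_iff, mem_ofPred_eq, eq_iff_iff]
    refine forall₂_congr fun G hG => ?_
    rw [dependsOn_selectedCard G fun v hv => h v ?_]
    have := Finset.disjoint_right.1 (not_not.1 (hT G hG)) hv
    simpa using this

/-- In a hypergraph with polynomial tails, every edge meets at most `N * (C * N ^ C)` edges. -/
lemma HasPolyTails.card_filter_not_disjoint_le {V : Type*} [DecidableEq V] {H : Finset (Finset V)}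
    {N C : ℕ} (hH : HasPolyTails (H : Set (Finset V)) N C) (hN : 0 < N) {F : Finset V}
    (hF : F ∈ H) :
    ((H.filter fun G => ¬ Disjoint F G).card : ℝ) ≤ N * (C * (N : ℝ) ^ C) := by
  have hN' : (0 : ℝ) < N := by exact_mod_cast hN
  have hN₁ : (1 : ℝ) ≤ N := by exact_mod_cast hN
  have hdeg : ∀ v, (H.filter (v ∈ ·)).card ≤ C * N ^ C := by
    intro v
    have h := hH.2 v (N : ℝ)⁻¹ (by positivity) (inv_le_one_of_one_le₀ hN₁)
    have hset : {G | G ∈ (H : Set (Finset V)) ∧ v ∈ G ∧ (N : ℝ)⁻¹ ≤ (G.card : ℝ) / N} =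
        ((H.filter (v ∈ ·) : Finset (Finset V)) : Set (Finset V)) := by
      ext G
      simp only [Finset.mem_coe, mem_ofPred_eq, Finset.mem_filter]
      refine ⟨fun h => ⟨h.1, h.2.1⟩, fun h => ⟨h.1, h.2, ?_⟩⟩
      rw [inv_eq_one_div]
      gcongr
      exact_mod_cast Finset.card_pos.2 ⟨v, h.2⟩
    rw [hset, ncard_coe_finset, inv_inv] at h
    exact_mod_cast h
  have hsub : (H.filter fun G => ¬ Disjoint F G) ⊆ F.biUnion fun v => H.filter (v ∈ ·) := by
    intro G hG
    obtain ⟨hGH, hFG⟩ := Finset.mem_filter.1 hG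
    obtain ⟨v, hvF, hvG⟩ := Finset.not_disjoint_iff.1 hFG
    exact Finset.mem_biUnion.2 ⟨v, hvF, Finset.mem_filter.2 ⟨hGH, hvG⟩⟩
  have h := (Finset.card_le_card hsub).trans
    ((Finset.card_biUnion_le_card_mul F _ _ fun v _ => hdeg v).trans
      (Nat.mul_le_mul_right _ (hH.1 F hF)))
  exact_mod_cast h

/-- The counts `|S ∩ F|` forbidden by the goodness conditions for an edge `F`. -/
def badCounts {V : Type*} (N C : ℕ) (m : ℝ) (F : Finset V) : Set ℕ :=
  {k | ¬ ((m ^ (-(2 : ℝ)/3) < (F.card : ℝ) / N →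
      (1 - m ^ (-(1 : ℝ)/12)) * m * ((F.card : ℝ) / N) ≤ k ∧
      k ≤ (1 + m ^ (-(1 : ℝ)/12)) * m * ((F.card : ℝ) / N)) ∧
    (m ^ (-(2 : ℝ)) < (F.card : ℝ) / N → (F.card : ℝ) / N ≤ m ^ (-(2 : ℝ)/3) →
      k ≤ (1 + m ^ (-(1 : ℝ)/12)) * m ^ ((1 : ℝ)/3)) ∧
    ((F.card : ℝ) / N ≤ m ^ (-(2 : ℝ)) → k ≤ 6 * C + 3))}

lemma isGoodSet_of_selectedCard_notMem {V : Type*} {H : Set (Finset V)} {N C : ℕ} {m : ℝ}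
    {ω : V → Bool} (h : ∀ F ∈ H, selectedCard F ω ∉ badCounts N C m F) :
    IsGoodSet H N C m {v | ω v = true} := by
  have hcard : ∀ F : Finset V, ({v | ω v = true} ∩ (F : Set V)).ncard = selectedCard F ω := by
    intro F
    rw [selectedCard, ← ncard_coe_finset, Finset.coe_filter]
    congr 1
    ext v
    simp [and_comm]
  simp only [badCounts, mem_ofPred_eq, not_not] at h
  simp only [IsGoodSet, hcard]
  exact ⟨fun F hF h₁ _ => (h F hF).1 h₁, fun F hF => (h F hF).2.1, fun F hF => (h F hF).2.2⟩

lemma measureReal_badCounts_le {V : Type*} [Fintype V] {N C : ℕ} {m : ℝ} (p : unitInterval)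
    (hp : (p : ℝ) = m / N) (hm : 1 ≤ m) {q : ℝ}
    (hexp : 2 * Real.exp (-(m ^ ((1 : ℝ)/6) / 4)) ≤ q) (hpow : 3 * (m ^ (6 * C + 4))⁻¹ ≤ q)
    (F : Finset V) :
    (randomSubset V p).real {ω | selectedCard F ω ∈ badCounts N C m F} ≤ q := by
  have hm₀ : 0 < m := by linarith
  set w := (F.card : ℝ) / N with hw
  set δ := m ^ (-(1 : ℝ)/12) with hδ
  have hmean : (F.card : ℝ) * p = m * w := by rw [hp, hw]; ring
  have hw₀ : 0 ≤ w := by positivity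
  have hδ₀ : 0 ≤ δ := by positivity
  have hδ₁ : δ ≤ 1 := Real.rpow_le_one_of_one_le_of_nonpos hm (by norm_num)
  have hδsq : m ^ ((1 : ℝ)/3) * δ ^ 2 = m ^ ((1 : ℝ)/6) := by
    rw [hδ, ← Real.rpow_natCast, ← Real.rpow_mul hm₀.le, ← Real.rpow_add hm₀]
    norm_num
  have hthird : m * m ^ (-(2 : ℝ)/3) = m ^ ((1 : ℝ)/3) := by
    rw [← Real.rpow_one_add' hm₀.le (by norm_num)]
    norm_num
  have htail : ∀ M, m ^ ((1 : ℝ)/3) ≤ M →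
      Real.exp (-(M * δ ^ 2 / 4)) ≤ Real.exp (-(m ^ ((1 : ℝ)/6) / 4)) := by
    intro M hM
    rw [← hδsq]
    gcongr
  have hlt : m ^ (-(2 : ℝ)) ≤ m ^ (-(2 : ℝ)/3) :=
    Real.rpow_le_rpow_of_exponent_le hm (by norm_num)
  have hexp₀ := Real.exp_pos (-(m ^ ((1 : ℝ)/6) / 4))
  rcases le_or_gt w (m ^ (-(2 : ℝ))) with hlight | hlight
  · have hsub : {ω | selectedCard F ω ∈ badCounts N C m F} ⊆
        {ω : V → Bool | ((6 * C + 4 : ℕ) : ℝ) ≤ selectedCard F ω} := by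
      intro ω hω
      by_contra h
      rw [mem_ofPred_eq, Nat.cast_le] at h
      exact hω ⟨fun h' => absurd h' (by rw [← hw]; linarith),
        fun h' => absurd h' (by rw [← hw]; linarith), fun _ => by omega⟩
    refine (measureReal_mono hsub).trans ((measureReal_selectedCard_ge_le p F
      (Real.log_nonneg hm) _).trans (le_trans ?_ hpow))
    rw [Real.exp_log hm₀, hmean, sub_eq_add_neg, Real.exp_add, Real.exp_neg,
      mul_comm (Real.log m), Real.exp_nat_mul, Real.exp_log hm₀]
    have hmw : m ^ 2 * w ≤ 1 := by
      calc m ^ 2 * w ≤ m ^ 2 * m ^ (-(2 : ℝ)) := by gcongr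
        _ = 1 := by
          rw [Real.rpow_neg hm₀.le, Real.rpow_two]
          exact mul_inv_cancel₀ (by positivity)
    have h1 : m * w * (m - 1) ≤ 1 := by nlinarith [mul_nonneg hm₀.le hw₀]
    gcongr
    exact (Real.exp_le_exp.2 h1).trans (by linarith [Real.exp_one_lt_d9])
  rcases le_or_gt w (m ^ (-(2 : ℝ)/3)) with hmed | hheavy
  · have hsub : {ω | selectedCard F ω ∈ badCounts N C m F} ⊆
        {ω : V → Bool | (1 + δ) * m ^ ((1 : ℝ)/3) ≤ selectedCard F ω} := by
      intro ω hω
      by_contra h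
      rw [mem_ofPred_eq, not_le] at h
      exact hω ⟨fun h' => absurd h' (by rw [← hw]; linarith), fun _ _ => h.le,
        fun h' => absurd h' (by rw [← hw]; linarith)⟩
    refine (measureReal_mono hsub).trans ((measureReal_selectedCard_ge_le_exp p F hδ₀ hδ₁ ?_).trans
      ((htail _ le_rfl).trans (by linarith)))
    rw [hmean, ← hthird]
    gcongr
  · have hM : m ^ ((1 : ℝ)/3) ≤ F.card * p := by
      rw [hmean, ← hthird]
      gcongr
    have hsub : {ω | selectedCard F ω ∈ badCounts N C m F} ⊆
        {ω : V → Bool | (1 + δ) * ((F.card : ℝ) * p) ≤ selectedCard F ω} ∪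
          {ω : V → Bool | selectedCard F ω ≤ (1 - δ) * ((F.card : ℝ) * p)} := by
      intro ω hω
      by_contra h
      rw [mem_union, not_or, mem_ofPred_eq, mem_ofPred_eq, not_le, not_le, hmean, ← mul_assoc,
        ← mul_assoc] at h
      exact hω ⟨fun _ => ⟨h.2.le, h.1.le⟩, fun _ h' => absurd h' (by rw [← hw]; linarith),
        fun h' => absurd h' (by rw [← hw]; linarith)⟩
    have h₁ := (measureReal_selectedCard_ge_le_exp p F hδ₀ hδ₁ le_rfl).trans (htail _ hM)
    have h₂ := (measureReal_selectedCard_le_le_exp p F hδ₀ hδ₁).trans (htail _ hM)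
    linarith [(measureReal_mono hsub).trans (measureReal_union_le (μ := randomSubset V p) _ _)]

lemma eventually_two_mul_exp_neg_rpow_le (k : ℕ) :
    ∀ᶠ m : ℝ in Filter.atTop, 2 * Real.exp (-(m ^ ((1 : ℝ)/6) / 4)) ≤ 3 * (m ^ k)⁻¹ := by
  have h : Filter.Tendsto (fun m : ℝ => (m ^ ((1 : ℝ)/6)) ^ (6 * k : ℝ) *
      Real.exp (-(1 / 4) * m ^ ((1 : ℝ)/6))) Filter.atTop (nhds 0) :=
    (tendsto_rpow_mul_exp_neg_mul_atTop_nhds_zero (6 * k : ℝ) (1 / 4) (by norm_num)).comp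
      (tendsto_rpow_atTop (by norm_num))
  filter_upwards [h.eventually_le_const (show (0 : ℝ) < 1 by norm_num),
    Filter.eventually_gt_atTop 0] with m hm hm₀
  have hpow : (m ^ ((1 : ℝ)/6)) ^ (6 * k : ℝ) = m ^ k := by
    rw [← Real.rpow_mul hm₀.le, ← Real.rpow_natCast]
    congr 1
    ring
  rw [hpow, neg_mul, one_div_mul_eq_div] at hm
  rw [← div_eq_mul_inv, le_div_iff₀ (by positivity)]
  linarith

end RandomSubset

/-- base case. For every `C ∈ ℕ` there is `K = K(C)` such that: whenever `H`
is a hypergraph on a finite vertex set `V` with polynomial tails (parameters `N`, `C`) and `m`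
is a real with `K ≤ m ≤ N ≤ m³`, there exists an `m`-good set `S ⊆ V`. -/
theorem good_set_base_case (C : ℕ) :
    ∃ K : ℝ, ∀ (V : Type) [Fintype V] (H : Set (Finset V)) (N : ℕ) (m : ℝ),
      HasPolyTails H N C → K ≤ m → m ≤ (N : ℝ) → (N : ℝ) ≤ m ^ 3 →
      ∃ S : Set V, IsGoodSet H N C m S := by
  obtain ⟨K₀, hK₀⟩ := Filter.eventually_atTop.1 (eventually_two_mul_exp_neg_rpow_le (6 * C + 4))
  refine ⟨max K₀ (12 * C + 7), fun V _ H N m hH hKm hmN hNm => ?_⟩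
  classical
  obtain ⟨H, rfl⟩ : ∃ H' : Finset (Finset V), H = H' :=
    ⟨(Set.toFinite H).toFinset, by simp⟩
  have hm : 12 * (C : ℝ) + 7 ≤ m := (le_max_right _ _).trans hKm
  have hC₀ : (0 : ℝ) ≤ C := Nat.cast_nonneg C
  have hm₁ : 1 ≤ m := by linarith
  have hm₀ : 0 < m := by linarith
  have hN₀ : (0 : ℝ) < N := by linarith
  let p : unitInterval := ⟨m / N, by positivity, (div_le_one hN₀).2 hmN⟩
  have hqd : 4 * (3 * (m ^ (6 * C + 4))⁻¹ * (N * (C * (N : ℝ) ^ C))) ≤ 1 := by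
    have hNC : (N : ℝ) * (C * (N : ℝ) ^ C) ≤ C * m ^ (3 * C + 3) := by
      calc (N : ℝ) * (C * (N : ℝ) ^ C) ≤ m ^ 3 * (C * (m ^ 3) ^ C) := by gcongr
        _ = C * m ^ (3 * C + 3) := by ring
    have hdeg : 12 * C * m ^ (3 * C + 3) ≤ m ^ (6 * C + 4) := by
      calc 12 * C * m ^ (3 * C + 3) ≤ m * m ^ (3 * C + 3) := by gcongr; linarith
        _ = m ^ (3 * C + 4) := by ring
        _ ≤ m ^ (6 * C + 4) := pow_le_pow_right₀ hm₁ (by omega)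
    calc 4 * (3 * (m ^ (6 * C + 4))⁻¹ * (N * (C * (N : ℝ) ^ C)))
        ≤ 4 * (3 * (m ^ (6 * C + 4))⁻¹ * (C * m ^ (3 * C + 3))) := by gcongr
      _ = (12 * C * m ^ (3 * C + 3)) / m ^ (6 * C + 4) := by ring
      _ ≤ 1 := (div_le_one (by positivity)).2 hdeg
  have hq : 2 * (3 * (m ^ (6 * C + 4))⁻¹) < 1 := by
    have h := le_self_pow₀ hm₁ (show 6 * C + 4 ≠ 0 by omega)
    rw [← mul_assoc, ← div_eq_mul_inv, div_lt_one (by positivity)]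
    linarith
  obtain ⟨ω, hω⟩ := exists_selectedCard_notMem p H (badCounts N C m) _ _ (by positivity) hq hqd
    (fun F hF => hH.card_filter_not_disjoint_le (by exact_mod_cast hN₀) hF)
    fun F _ => measureReal_badCounts_le p rfl hm₁ (hK₀ m ((le_max_left _ _).trans hKm)) le_rfl F
  exact ⟨_, isGoodSet_of_selectedCard_notMem hω⟩
end
end

section
/- Let n be a positive integer and let m be a real number with 10^36 ≤ m and m³ ≤ n, and set m₀ = m³. If there exists an ((m₀+1)/n)-spread probability distribution over subsets of [n]² supported on m₀-nice sets, then there exists an ((m+1)/n)-spread probability distribution over subsets of [n]² supported on m-nice sets. -/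
open Set

noncomputable section

/-- The grid `[n]² = {1,…,n}²` regarded as a subset of `ℝ²`. -/
def grid2 (n : ℕ) : Set (ℝ × ℝ) :=
  {p | ∃ a b : ℤ, 1 ≤ a ∧ a ≤ (n : ℤ) ∧ 1 ≤ b ∧ b ≤ (n : ℤ) ∧ p = ((a : ℝ), (b : ℝ))}

/-- An (affine) line in `ℝ²`: a one-dimensional affine subspace of `ℝ²`. -/
def IsLine (L : AffineSubspace ℝ (ℝ × ℝ)) : Prop :=
  Module.finrank ℝ L.direction = 1

/-- Membership in `𝓛`: lines intersecting the grid `[n]²` in at least two points. -/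
def InLines (n : ℕ) (L : AffineSubspace ℝ (ℝ × ℝ)) : Prop :=
  IsLine L ∧ 2 ≤ (grid2 n ∩ (L : Set (ℝ × ℝ))).ncard

/-- The weight `w(L) = |[n]² ∩ L| / n` of a line `L`. -/
def lineWeight (n : ℕ) (L : AffineSubspace ℝ (ℝ × ℝ)) : ℝ :=
  ((grid2 n ∩ (L : Set (ℝ × ℝ))).ncard : ℝ) / n

/-- The subset of `ℝ²` corresponding to `I × J` for sets `I, J ⊆ {1,…,n}` of integers. -/
def gridRect (I J : Finset ℤ) : Set (ℝ × ℝ) :=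
  {p | ∃ a ∈ I, ∃ b ∈ J, p = ((a : ℝ), (b : ℝ))}

/-- A set `S ⊆ [n]²` is `m`-nice. -/
def IsNice (n : ℕ) (m : ℝ) (S : Set (ℝ × ℝ)) : Prop :=
  S ⊆ grid2 n ∧
  -- (1) concentration for heavy lines
  (∀ L : AffineSubspace ℝ (ℝ × ℝ), InLines n L →
    m ^ (-(2 : ℝ)/3) < lineWeight n L → lineWeight n L ≤ 1 →
    (1 - m ^ (-(1 : ℝ)/12)) * m * lineWeight n L ≤ ((S ∩ (L : Set (ℝ × ℝ))).ncard : ℝ) ∧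
    ((S ∩ (L : Set (ℝ × ℝ))).ncard : ℝ) ≤ (1 + m ^ (-(1 : ℝ)/12)) * m * lineWeight n L) ∧
  -- (2) upper bound for medium lines
  (∀ L : AffineSubspace ℝ (ℝ × ℝ), InLines n L →
    m ^ (-(2 : ℝ)) < lineWeight n L → lineWeight n L ≤ m ^ (-(2 : ℝ)/3) →
    ((S ∩ (L : Set (ℝ × ℝ))).ncard : ℝ) ≤ (1 + m ^ (-(1 : ℝ)/12)) * m ^ ((1 : ℝ)/3)) ∧
  -- (3) very few points on light lines
  (∀ L : AffineSubspace ℝ (ℝ × ℝ), InLines n L →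
    lineWeight n L ≤ m ^ (-(2 : ℝ)) →
    (S ∩ (L : Set (ℝ × ℝ))).ncard ≤ 14) ∧
  -- (4) quasirandomness
  (∀ I J : Finset ℤ, ↑I ⊆ Set.Icc (1 : ℤ) (n : ℤ) → ↑J ⊆ Set.Icc (1 : ℤ) (n : ℤ) →
    (n : ℝ)/10 ≤ I.card → (n : ℝ)/10 ≤ J.card →
    (1 - m ^ (-(1 : ℝ)/12)) * I.card * J.card * m / n ≤ ((S ∩ gridRect I J).ncard : ℝ) ∧
    ((S ∩ gridRect I J).ncard : ℝ) ≤ (1 + m ^ (-(1 : ℝ)/12)) * I.card * J.card * m / n)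

/-- A probability distribution over subsets of `[n]²` is `p`-spread if
`ℙ[T ⊆ S] ≤ p^|T|` for every `T ⊆ [n]²`. -/
def IsSpread (n : ℕ) (p : ℝ) (μ : PMF (Finset (ℝ × ℝ))) : Prop :=
  ∀ T : Finset (ℝ × ℝ), ↑T ⊆ grid2 n →
    (μ.toOuterMeasure {S | T ⊆ S}).toReal ≤ p ^ T.card

/-- A distribution is supported on `m`-nice sets. -/
def SupportedOnNice (n : ℕ) (m : ℝ) (μ : PMF (Finset (ℝ × ℝ))) : Prop :=
  ∀ S : Finset (ℝ × ℝ), μ S ≠ 0 → IsNice n m ↑S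

/-- Expectation of `f S` when `S ⊆ V` contains each point of `V` independently with
probability `q`. -/
def bexp {α : Type*} [DecidableEq α] (V : Finset α) (q : ℝ) (f : Finset α → ℝ) : ℝ :=
  ∑ S ∈ V.powerset, q ^ S.card * (1 - q) ^ (V \ S).card * f S

open Classical in
/-- Probability of the event `A` when `S ⊆ V` contains each point of `V` independently with
probability `q`. -/
def bprob {α : Type*} [DecidableEq α] (V : Finset α) (q : ℝ) (A : Finset α → Prop) : ℝ :=
  bexp V q (fun S => if A S then 1 else 0)

section RandomSubset

variable {α : Type*} [DecidableEq α] {V : Finset α} {q : ℝ}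

theorem bexp_empty (q : ℝ) (f : Finset α → ℝ) : bexp ∅ q f = f ∅ := by
  simp [bexp]

theorem bexp_insert {a : α} (ha : a ∉ V) (q : ℝ) (f : Finset α → ℝ) :
    bexp (insert a V) q f =
      (1 - q) * bexp V q f + q * bexp V q (fun S => f (insert a S)) := by
  unfold bexp
  rw [Finset.sum_powerset_insert ha, Finset.mul_sum, Finset.mul_sum]
  congr 1
  · refine Finset.sum_congr rfl fun S hS => ?_
    have hS' := Finset.mem_powerset.1 hS
    have haS : a ∉ S := fun h => ha (hS' h)
    rw [Finset.insert_sdiff_of_notMem _ haS,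
      Finset.card_insert_of_notMem (by simp [ha])]
    ring
  · refine Finset.sum_congr rfl fun S hS => ?_
    have hS' := Finset.mem_powerset.1 hS
    have haS : a ∉ S := fun h => ha (hS' h)
    have h2 : insert a V \ insert a S = V \ S := by
      ext x
      simp only [Finset.mem_sdiff, Finset.mem_insert]
      constructor
      · rintro ⟨h1 | h1, h2⟩
        · exact absurd (Or.inl h1) h2
        · exact ⟨h1, fun h => h2 (Or.inr h)⟩
      · rintro ⟨h1, h2⟩
        refine ⟨Or.inr h1, ?_⟩
        rintro (h | h)
        · exact ha (h ▸ h1)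
        · exact h2 h
    rw [h2, Finset.card_insert_of_notMem haS]
    ring

theorem bexp_const (V : Finset α) (q c : ℝ) : bexp V q (fun _ => c) = c := by
  induction V using Finset.induction_on with
  | empty => simp [bexp_empty]
  | insert a V ha ih => rw [bexp_insert ha, ih]; ring

theorem bexp_const_mul (V : Finset α) (q c : ℝ) (f : Finset α → ℝ) :
    bexp V q (fun S => c * f S) = c * bexp V q f := by
  unfold bexp
  rw [Finset.mul_sum]
  exact Finset.sum_congr rfl fun S _ => by ring

theorem bexp_add (V : Finset α) (q : ℝ) (f g : Finset α → ℝ) :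
    bexp V q (fun S => f S + g S) = bexp V q f + bexp V q g := by
  unfold bexp
  rw [← Finset.sum_add_distrib]
  exact Finset.sum_congr rfl fun S _ => by ring

theorem bexp_sum {ι : Type*} (V : Finset α) (q : ℝ) (K : Finset ι) (f : ι → Finset α → ℝ) :
    bexp V q (fun S => ∑ i ∈ K, f i S) = ∑ i ∈ K, bexp V q (f i) := by
  unfold bexp
  rw [Finset.sum_comm]
  exact Finset.sum_congr rfl fun S _ => by rw [Finset.mul_sum]

theorem bexp_mono (hq0 : 0 ≤ q) (hq1 : q ≤ 1) {f g : Finset α → ℝ}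
    (h : ∀ S, S ⊆ V → f S ≤ g S) : bexp V q f ≤ bexp V q g := by
  unfold bexp
  refine Finset.sum_le_sum fun S hS => ?_
  have : 0 ≤ 1 - q := by linarith
  exact mul_le_mul_of_nonneg_left (h S (Finset.mem_powerset.1 hS)) (by positivity)

theorem bexp_congr {f g : Finset α → ℝ} (h : ∀ S, S ⊆ V → f S = g S) :
    bexp V q f = bexp V q g := by
  unfold bexp
  exact Finset.sum_congr rfl fun S hS => by rw [h S (Finset.mem_powerset.1 hS)]

/-- Functions depending on disjoint sets of coordinates are independent. -/
theorem bexp_mul_of_disjoint (V : Finset α) (q : ℝ) (B : Finset α) (f g : Finset α → ℝ)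
    (hf : ∀ S, f S = f (S ∩ B)) (hg : ∀ S, g S = g (S \ B)) :
    bexp V q (fun S => f S * g S) = bexp V q f * bexp V q g := by
  induction V using Finset.induction_on generalizing f g with
  | empty => simp [bexp_empty]
  | insert a V ha ih =>
    rw [bexp_insert ha, bexp_insert ha, bexp_insert ha, ih f g hf hg]
    by_cases haB : a ∈ B
    · have h1 : ∀ S, g (insert a S) = g S := fun S => by
        rw [hg, hg S, Finset.insert_sdiff_of_mem _ haB]
      simp only [h1]
      rw [ih (fun S => f (insert a S)) g (fun S => ?_) hg]
      · ring
      · rw [hf, hf (insert a (S ∩ B)), Finset.insert_inter_of_mem haB,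
          Finset.insert_inter_of_mem haB, Finset.inter_assoc, Finset.inter_self]
    · have h1 : ∀ S, f (insert a S) = f S := fun S => by
        rw [hf, hf S, Finset.insert_inter_of_notMem haB]
      simp only [h1]
      rw [ih f (fun S => g (insert a S)) hf (fun S => ?_)]
      · ring
      · rw [hg, hg (insert a (S \ B)), Finset.insert_sdiff_of_notMem _ haB,
          Finset.insert_sdiff_of_notMem _ haB, Finset.sdiff_idem]

theorem bexp_pow_card_inter (V B : Finset α) (q c : ℝ) :
    bexp V q (fun S => c ^ (S ∩ B).card) = (1 - q + q * c) ^ (V ∩ B).card := by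
  induction V using Finset.induction_on with
  | empty => simp [bexp_empty]
  | insert a V ha ih =>
    rw [bexp_insert ha, ih]
    by_cases haB : a ∈ B
    · have h1 : bexp V q (fun S => c ^ (insert a S ∩ B).card) =
          bexp V q (fun S => c * c ^ (S ∩ B).card) := bexp_congr fun S hS => by
        rw [Finset.insert_inter_of_mem haB,
          Finset.card_insert_of_notMem (fun h => ha (hS (Finset.mem_inter.1 h).1)), pow_succ']
      rw [h1, bexp_const_mul, ih, Finset.insert_inter_of_mem haB,
          Finset.card_insert_of_notMem (fun h => ha (Finset.mem_inter.1 h).1)]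
      ring
    · simp only [Finset.insert_inter_of_notMem haB]
      rw [ih]
      ring

theorem bprob_mono (hq0 : 0 ≤ q) (hq1 : q ≤ 1) {A B : Finset α → Prop}
    (h : ∀ S, S ⊆ V → A S → B S) : bprob V q A ≤ bprob V q B := by
  classical
  refine bexp_mono hq0 hq1 fun S hS => ?_
  by_cases hA : A S
  · simp [hA, h S hS hA]
  · simp only [hA, if_false]; split_ifs <;> norm_num

theorem bprob_nonneg (hq0 : 0 ≤ q) (hq1 : q ≤ 1) (A : Finset α → Prop) : 0 ≤ bprob V q A := by
  classical
  have := bexp_mono (V := V) hq0 hq1 (f := fun _ => 0) (g := fun S => if A S then 1 else 0)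
    (fun S _ => by positivity)
  rwa [bexp_const] at this

theorem bprob_le_bexp (hq0 : 0 ≤ q) (hq1 : q ≤ 1) {A : Finset α → Prop} {f : Finset α → ℝ}
    (hf : ∀ S, 0 ≤ f S) (h : ∀ S, S ⊆ V → A S → 1 ≤ f S) : bprob V q A ≤ bexp V q f := by
  classical
  refine bexp_mono hq0 hq1 fun S hS => ?_
  split_ifs with hA
  · exact h S hS hA
  · exact hf S

theorem bprob_le_sum {ι : Type*} (hq0 : 0 ≤ q) (hq1 : q ≤ 1) (K : Finset ι)
    {A : Finset α → Prop} {B : ι → Finset α → Prop}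
    (h : ∀ S, S ⊆ V → A S → ∃ i ∈ K, B i S) :
    bprob V q A ≤ ∑ i ∈ K, bprob V q (B i) := by
  classical
  have h1 := bexp_sum V q K (fun i S => if B i S then (1 : ℝ) else 0)
  have h2 : ∑ i ∈ K, bprob V q (B i) =
      ∑ i ∈ K, bexp V q (fun S => if B i S then (1 : ℝ) else 0) := by
    refine Finset.sum_congr rfl fun i _ => ?_
    unfold bprob
    congr!
  rw [h2, ← h1]
  refine bprob_le_bexp hq0 hq1 (fun S => Finset.sum_nonneg fun i _ => by positivity)
    fun S hS hA => ?_
  obtain ⟨i, hi, hB⟩ := h S hS hA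
  refine le_trans ?_ (Finset.single_le_sum
    (f := fun i => if B i S then (1 : ℝ) else 0) (fun i _ => by positivity) hi)
  simp [hB]

theorem bprob_and_of_disjoint (V : Finset α) (q : ℝ) (B : Finset α) {A A' : Finset α → Prop}
    (hA : ∀ S, A S ↔ A (S ∩ B)) (hA' : ∀ S, A' S ↔ A' (S \ B)) :
    bprob V q (fun S => A S ∧ A' S) = bprob V q A * bprob V q A' := by
  classical
  unfold bprob
  rw [← bexp_mul_of_disjoint V q B]
  · refine bexp_congr fun S _ => ?_
    by_cases h1 : A S <;> by_cases h2 : A' S <;> simp [h1, h2]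
  · intro S; simp only [hA S]
  · intro S; simp only [hA' S]

theorem bprob_insert {a : α} (ha : a ∉ V) (q : ℝ) (A : Finset α → Prop) :
    bprob (insert a V) q A =
      (1 - q) * bprob V q A + q * bprob V q (fun S => A (insert a S)) :=
  bexp_insert ha q _

theorem bprob_eq_zero {A : Finset α → Prop} (h : ∀ S, S ⊆ V → ¬ A S) : bprob V q A = 0 :=
  (bexp_congr fun S hS => if_neg (h S hS)).trans (bexp_const V q 0)

theorem bprob_superset {T : Finset α} (hT : T ⊆ V) (q : ℝ) :
    bprob V q (fun S => T ⊆ S) = q ^ T.card := by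
  induction V using Finset.induction_on generalizing T with
  | empty =>
    obtain rfl := Finset.subset_empty.1 hT
    simp [bprob, bexp_empty]
  | insert a V ha ih =>
    rw [bprob_insert ha]
    by_cases haT : a ∈ T
    · have h : ∀ S, T ⊆ insert a S ↔ T.erase a ⊆ S := fun S => Finset.subset_insert_iff
      simp only [h]
      rw [bprob_eq_zero fun S hS h => ha (hS (h haT)), ih (Finset.subset_insert_iff.1 hT),
        mul_zero, zero_add, ← pow_succ', Finset.card_erase_add_one haT]
    · simp only [Finset.subset_insert_iff_of_notMem haT]
      rw [ih ((Finset.subset_insert_iff_of_notMem haT).1 hT)]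
      ring

theorem bprob_and_add_and_not (V : Finset α) (q : ℝ) (A B : Finset α → Prop) :
    bprob V q (fun S => A S ∧ B S) + bprob V q (fun S => A S ∧ ¬ B S) = bprob V q A := by
  classical
  unfold bprob
  rw [← bexp_add]
  refine bexp_congr fun S _ => ?_
  by_cases h1 : A S <;> by_cases h2 : B S <;> simp [h1, h2]

/-- Moment generating function bound for the number of chosen points in a set. -/
theorem bexp_pow_card_inter_le (hq0 : 0 ≤ q) (hq1 : q ≤ 1) (B : Finset α) (hB : B ⊆ V) {c : ℝ}
    (hc : 0 ≤ c) :
    bexp V q (fun S => c ^ (S ∩ B).card) ≤ Real.exp (q * B.card * (c - 1)) := by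
  rw [bexp_pow_card_inter, Finset.inter_eq_right.2 hB]
  have h1 : 1 - q + q * c ≤ Real.exp (q * (c - 1)) := by
    have := Real.add_one_le_exp (q * (c - 1)); linarith
  calc (1 - q + q * c) ^ B.card ≤ Real.exp (q * (c - 1)) ^ B.card :=
        pow_le_pow_left₀ (by nlinarith [mul_nonneg hq0 hc]) h1 _
    _ = _ := by rw [← Real.exp_nat_mul]; congr 1; ring

/-- Chernoff bound, upper tail. -/
theorem bprob_card_inter_gt_le (hq0 : 0 ≤ q) (hq1 : q ≤ 1) (B : Finset α) (hB : B ⊆ V)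
    {u M : ℝ} (hu : 10 ≤ u) (hM : 0 ≤ M) (hK : q * B.card ≤ (1 + 1 / u ^ 3) * M) :
    bprob V q (fun S => (1 + 1 / u) * M < (S ∩ B).card) ≤ Real.exp (-(M / (9 * u ^ 2))) := by
  set t : ℝ := 1 / (3 * u) with ht
  have ht0 : 0 < t := by positivity
  have ht1 : t ≤ 1 := by rw [ht, div_le_one (by positivity)]; linarith
  have hfin : bprob V q (fun S => (1 + 1 / u) * M < (S ∩ B).card) ≤
      bexp V q (fun S => Real.exp (-(t * ((1 + 1 / u) * M))) * Real.exp t ^ (S ∩ B).card) := by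
    refine bprob_le_bexp hq0 hq1 (fun S => by positivity) fun S _ h => ?_
    rw [← Real.exp_nat_mul, ← Real.exp_add]
    apply Real.one_le_exp
    nlinarith
  refine hfin.trans ?_
  rw [bexp_const_mul]
  refine (mul_le_mul_of_nonneg_left
    (bexp_pow_card_inter_le hq0 hq1 B hB (Real.exp_nonneg t)) (Real.exp_nonneg _)).trans ?_
  rw [← Real.exp_add, Real.exp_le_exp]
  have h1 : Real.exp t - 1 ≤ t + t ^ 2 := by
    have := Real.abs_exp_sub_one_sub_id_le (x := t) (by rw [abs_of_pos ht0]; exact ht1)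
    have := (abs_le.1 this).2
    linarith
  have h2 : q * B.card * (Real.exp t - 1) ≤ (1 + 1 / u ^ 3) * M * (t + t ^ 2) :=
    mul_le_mul hK h1 (by have := Real.add_one_le_exp t; linarith) (by positivity)
  have hv : ∀ v : ℝ, 0 < v → v ≤ 1 / 10 →
      (1 + v ^ 3) * (v / 3 + (v / 3) ^ 2) - v / 3 * (1 + v) + v ^ 2 / 9 ≤ 0 := by
    intro v hv0 hv1
    have : (1 + v ^ 3) * (v / 3 + (v / 3) ^ 2) - v / 3 * (1 + v) + v ^ 2 / 9 =
      v ^ 2 / 9 * (-1 + 3 * v ^ 2 + v ^ 3) := by ring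
    rw [this]
    apply mul_nonpos_of_nonneg_of_nonpos (by positivity)
    nlinarith [pow_le_pow_left₀ hv0.le hv1 2, pow_le_pow_left₀ hv0.le hv1 3]
  have h3 := hv (1 / u) (by positivity) (by
    rw [div_le_div_iff₀ (by positivity) (by norm_num)]; linarith)
  have h4 : t = 1 / u / 3 := by rw [ht]; field_simp
  rw [← h4] at h3
  have h5 := mul_nonneg hM (neg_nonneg.2 h3)
  have h6 : M / (9 * u ^ 2) = M * ((1 / u) ^ 2 / 9) := by field_simp
  rw [h6]
  have h7 : 1 / u ^ 3 = (1 / u) ^ 3 := by simp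
  rw [h7] at h2
  linarith

/-- Chernoff bound, lower tail. -/
theorem bprob_card_inter_lt_le (hq0 : 0 ≤ q) (hq1 : q ≤ 1) (B : Finset α) (hB : B ⊆ V)
    {u M : ℝ} (hu : 10 ≤ u) (hM : 0 ≤ M) (hK : (1 - 1 / u ^ 3) * M ≤ q * B.card) :
    bprob V q (fun S => (S ∩ B).card < (1 - 1 / u) * M) ≤ Real.exp (-(M / (9 * u ^ 2))) := by
  set t : ℝ := 1 / (3 * u) with ht
  have ht0 : 0 < t := by positivity
  have ht1 : t ≤ 1 := by rw [ht, div_le_one (by positivity)]; linarith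
  have hfin : bprob V q (fun S => (S ∩ B).card < (1 - 1 / u) * M) ≤
      bexp V q (fun S => Real.exp (t * ((1 - 1 / u) * M)) * Real.exp (-t) ^ (S ∩ B).card) := by
    refine bprob_le_bexp hq0 hq1 (fun S => by positivity) fun S _ h => ?_
    rw [← Real.exp_nat_mul, ← Real.exp_add]
    apply Real.one_le_exp
    nlinarith
  refine hfin.trans ?_
  rw [bexp_const_mul]
  refine (mul_le_mul_of_nonneg_left
    (bexp_pow_card_inter_le hq0 hq1 B hB (Real.exp_nonneg (-t))) (Real.exp_nonneg _)).trans ?_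
  rw [← Real.exp_add, Real.exp_le_exp]
  have h1 : t - t ^ 2 ≤ 1 - Real.exp (-t) := by
    have := Real.abs_exp_sub_one_sub_id_le (x := -t) (by rw [abs_neg, abs_of_pos ht0]; exact ht1)
    have := (abs_le.1 this).2
    linarith
  have h2 : (1 - 1 / u ^ 3) * M * (t - t ^ 2) ≤ q * B.card * (1 - Real.exp (-t)) :=
    mul_le_mul hK h1 (by nlinarith) (by positivity)
  have hv : ∀ v : ℝ, 0 < v → v ≤ 1 / 10 →
      -((1 - v ^ 3) * (v / 3 - (v / 3) ^ 2)) + v / 3 * (1 - v) + v ^ 2 / 9 ≤ 0 := by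
    intro v hv0 hv1
    have : -((1 - v ^ 3) * (v / 3 - (v / 3) ^ 2)) + v / 3 * (1 - v) + v ^ 2 / 9 =
      v ^ 2 / 9 * (-1 + 3 * v ^ 2 - v ^ 3) := by ring
    rw [this]
    apply mul_nonpos_of_nonneg_of_nonpos (by positivity)
    nlinarith [pow_le_pow_left₀ hv0.le hv1 2, pow_pos hv0 3]
  have h3 := hv (1 / u) (by positivity) (by
    rw [div_le_div_iff₀ (by positivity) (by norm_num)]; linarith)
  have h4 : t = 1 / u / 3 := by rw [ht]; field_simp
  rw [← h4] at h3
  have h5 := mul_nonneg hM (neg_nonneg.2 h3)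
  have h6 : M / (9 * u ^ 2) = M * ((1 / u) ^ 2 / 9) := by field_simp
  rw [h6]
  have h7 : 1 / u ^ 3 = (1 / u) ^ 3 := by simp
  rw [h7] at h2
  linarith

/-- The Lovász local lemma in the symmetric form, with room to spare. -/
theorem bprob_and_forall_not_le {ι : Type*} (hq0 : 0 ≤ q) (hq1 : q ≤ 1) {p : ℝ} (hp : 0 ≤ p)
    {D : ℕ} (hpD : 4 * p * D ≤ 1) {J : Finset ι} {A : ι → Finset α → Prop} {W : ι → Finset α}
    (hA : ∀ i ∈ J, ∀ S S', S ∩ W i = S' ∩ W i → (A i S ↔ A i S'))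
    (hAp : ∀ i ∈ J, bprob V q (A i) ≤ p)
    (hD : ∀ i ∈ J, ∃ N : Finset ι, N.card ≤ D ∧ ∀ j ∈ J, ¬ Disjoint (W i) (W j) → j ∈ N)
    (K : Finset ι) (hK : K ⊆ J) {i : ι} (hi : i ∈ J) :
    bprob V q (fun S => A i S ∧ ∀ j ∈ K, ¬ A j S) ≤
      2 * p * bprob V q (fun S => ∀ j ∈ K, ¬ A j S) := by
  classical
  induction K using Finset.strongInduction generalizing i with
  | H K ih =>
  set K₁ := K.filter (fun j => ¬ Disjoint (W i) (W j)) with hK₁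
  set K₂ := K.filter (fun j => Disjoint (W i) (W j)) with hK₂
  have hP₂ := bprob_nonneg (V := V) hq0 hq1 (fun S => ∀ j ∈ K₂, ¬ A j S)
  have h1 : bprob V q (fun S => A i S ∧ ∀ j ∈ K, ¬ A j S) ≤
      p * bprob V q (fun S => ∀ j ∈ K₂, ¬ A j S) := by
    calc bprob V q (fun S => A i S ∧ ∀ j ∈ K, ¬ A j S)
        ≤ bprob V q (fun S => A i S ∧ ∀ j ∈ K₂, ¬ A j S) :=
          bprob_mono hq0 hq1 fun S _ h => ⟨h.1, fun j hj => h.2 j (Finset.mem_filter.1 hj).1⟩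
      _ = bprob V q (A i) * bprob V q (fun S => ∀ j ∈ K₂, ¬ A j S) := by
          refine bprob_and_of_disjoint V q (W i) (fun S => hA i hi _ _ ?_) fun S => ?_
          · rw [Finset.inter_assoc, Finset.inter_self]
          · refine forall₂_congr fun j hj => not_congr ?_
            obtain ⟨hjK, hd⟩ := Finset.mem_filter.1 hj
            refine hA j (hK hjK) _ _ ?_
            ext x
            simp only [Finset.mem_inter, Finset.mem_sdiff]
            have h₂ : x ∈ W j → x ∉ W i := fun h => Finset.disjoint_right.1 hd h
            tauto
      _ ≤ _ := mul_le_mul_of_nonneg_right (hAp i hi) hP₂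
  have hcard : K₁.card ≤ D := by
    obtain ⟨N, hN, hmem⟩ := hD i hi
    refine (Finset.card_le_card fun j hj => ?_).trans hN
    obtain ⟨hjK, hd⟩ := Finset.mem_filter.1 hj
    exact hmem j (hK hjK) hd
  have h2 : bprob V q (fun S => (∀ j ∈ K₂, ¬ A j S) ∧ ¬ ∀ j ∈ K, ¬ A j S) ≤
      1 / 2 * bprob V q (fun S => ∀ j ∈ K₂, ¬ A j S) := by
    calc _ ≤ ∑ j ∈ K₁, bprob V q (fun S => A j S ∧ ∀ j ∈ K₂, ¬ A j S) := by
          refine bprob_le_sum hq0 hq1 K₁ fun S _ h => ?_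
          obtain ⟨h, h'⟩ := h
          push Not at h'
          obtain ⟨j, hj, hAj⟩ := h'
          exact ⟨j, Finset.mem_filter.2 ⟨hj, fun hd => h j (Finset.mem_filter.2 ⟨hj, hd⟩) hAj⟩,
            hAj, h⟩
      _ ≤ ∑ _j ∈ K₁, 2 * p * bprob V q (fun S => ∀ j ∈ K₂, ¬ A j S) := by
          refine Finset.sum_le_sum fun j hj => ?_
          obtain ⟨hjK, hd⟩ := Finset.mem_filter.1 hj
          refine ih K₂ ?_ ((Finset.filter_subset _ _).trans hK) (hK hjK)
          refine Finset.ssubset_iff_subset_ne.2 ⟨Finset.filter_subset _ _, fun he => ?_⟩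
          rw [← he] at hjK
          exact hd (Finset.mem_filter.1 hjK).2
      _ = K₁.card * (2 * p) * bprob V q (fun S => ∀ j ∈ K₂, ¬ A j S) := by
          rw [Finset.sum_const, nsmul_eq_mul]; ring
      _ ≤ _ := by
          refine mul_le_mul_of_nonneg_right ?_ hP₂
          have : (K₁.card : ℝ) ≤ D := by exact_mod_cast hcard
          nlinarith
  have h3 := bprob_and_add_and_not V q (fun S => ∀ j ∈ K₂, ¬ A j S) (fun S => ∀ j ∈ K, ¬ A j S)
  have h4 : bprob V q (fun S => (∀ j ∈ K₂, ¬ A j S) ∧ ∀ j ∈ K, ¬ A j S) ≤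
      bprob V q (fun S => ∀ j ∈ K, ¬ A j S) := bprob_mono hq0 hq1 fun S _ h => h.2
  nlinarith

theorem pow_mul_bprob_le_bprob_union {ι : Type*} [DecidableEq ι] (hq0 : 0 ≤ q) (hq1 : q ≤ 1)
    {x : ℝ} (hx : x ≤ 1) {J : Finset ι} {A : ι → Finset α → Prop}
    (h : ∀ K ⊆ J, ∀ i ∈ J, bprob V q (fun S => A i S ∧ ∀ j ∈ K, ¬ A j S) ≤
      x * bprob V q (fun S => ∀ j ∈ K, ¬ A j S))
    {K K' : Finset ι} (hK : K ⊆ J) (hK' : K' ⊆ J) :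
    (1 - x) ^ K'.card * bprob V q (fun S => ∀ j ∈ K, ¬ A j S) ≤
      bprob V q (fun S => ∀ j ∈ K ∪ K', ¬ A j S) := by
  induction K' using Finset.induction_on with
  | empty => simp
  | insert a K' ha ih =>
    have ih' := ih ((Finset.subset_insert _ _).trans hK')
    have h1 := h (K ∪ K') (Finset.union_subset hK ((Finset.subset_insert _ _).trans hK')) a
      (hK' (Finset.mem_insert_self _ _))
    have h2 := bprob_and_add_and_not V q (fun S => ∀ j ∈ K ∪ K', ¬ A j S) (A a)
    have h3 : bprob V q (fun S => (∀ j ∈ K ∪ K', ¬ A j S) ∧ A a S) =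
        bprob V q (fun S => A a S ∧ ∀ j ∈ K ∪ K', ¬ A j S) := by simp only [and_comm]
    have h4 : bprob V q (fun S => (∀ j ∈ K ∪ K', ¬ A j S) ∧ ¬ A a S) ≤
        bprob V q (fun S => ∀ j ∈ K ∪ insert a K', ¬ A j S) :=
      bprob_mono hq0 hq1 fun S _ hS j hj => by
        rw [Finset.union_insert, Finset.mem_insert] at hj
        rcases hj with rfl | hj
        · exact hS.2
        · exact hS.1 j hj
    rw [Finset.card_insert_of_notMem ha, pow_succ']
    nlinarith [mul_le_mul_of_nonneg_left ih' (sub_nonneg.2 hx)]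

/-- The random subset conditioned on an event of positive probability. -/
theorem exists_pmf_conditioned (hq0 : 0 ≤ q) (hq1 : q ≤ 1) {G : Finset α → Prop}
    (hG : 0 < bprob V q G) :
    ∃ ν : PMF (Finset α), (∀ S, ν S ≠ 0 → S ⊆ V ∧ G S) ∧
      ∀ B : Finset α → Prop, (ν.toOuterMeasure {S | B S}).toReal =
        bprob V q (fun S => B S ∧ G S) / bprob V q G := by
  classical
  have hq1' : 0 ≤ 1 - q := by linarith
  set w : Finset α → ℝ := fun S =>
    if S ⊆ V ∧ G S then q ^ S.card * (1 - q) ^ (V \ S).card / bprob V q G else 0 with hw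
  have hw0 : ∀ S, 0 ≤ w S := fun S => by
    simp only [hw]; split_ifs
    · positivity
    · exact le_rfl
  have hsum : ∀ B : Finset α → Prop, ∑ S ∈ V.powerset, (if B S then w S else 0) =
      bprob V q (fun S => B S ∧ G S) / bprob V q G := by
    intro B
    nth_rw 1 [bprob]
    rw [bexp, Finset.sum_div]
    refine Finset.sum_congr rfl fun S hS => ?_
    have := Finset.mem_powerset.1 hS
    by_cases h1 : B S <;> by_cases h2 : G S <;> simp [hw, h1, h2, this]
  have h1 : ∑ S ∈ V.powerset, ENNReal.ofReal (w S) = 1 := by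
    rw [← ENNReal.ofReal_sum_of_nonneg fun S _ => hw0 S]
    have := hsum (fun _ => True)
    simp only [if_true, true_and] at this
    rw [this, div_self hG.ne', ENNReal.ofReal_one]
  refine ⟨PMF.ofFinset (fun S => ENNReal.ofReal (w S)) V.powerset h1 fun S hS => ?_, ?_, ?_⟩
  · rw [Finset.mem_powerset] at hS
    simp [hw, hS]
  · intro S hS
    rw [PMF.ofFinset_apply] at hS
    by_contra h
    simp [hw, h] at hS
  · intro B
    rw [PMF.toOuterMeasure_ofFinset_apply, tsum_eq_sum (s := V.powerset)]
    · rw [ENNReal.toReal_sum, ← hsum]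
      · refine Finset.sum_congr rfl fun S _ => ?_
        by_cases h : B S
        · simp [h, hw0 S]
        · simp [h]
      · intro S _
        by_cases h : B S <;> simp [h]
    · intro S hS
      rw [Finset.mem_powerset] at hS
      by_cases h : B S <;> simp [h, hw, hS]

/-- Conditioning a random subset on avoiding local events `A i` and one unlikely global event
changes the probability of containing a given set only slightly. -/
theorem exists_pmf_avoiding {ι : Type*} (hq0 : 0 ≤ q) (hq1 : q ≤ 1) {x ε : ℝ}
    (hx0 : 0 ≤ x) (hx : x < 1) (hε0 : 0 ≤ ε) (hε : ε < 1) {J : Finset ι}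
    {A : ι → Finset α → Prop} {W : ι → Finset α}
    (hA : ∀ i ∈ J, ∀ S S', S ∩ W i = S' ∩ W i → (A i S ↔ A i S'))
    (h : ∀ K ⊆ J, ∀ i ∈ J, bprob V q (fun S => A i S ∧ ∀ j ∈ K, ¬ A j S) ≤
      x * bprob V q (fun S => ∀ j ∈ K, ¬ A j S))
    {Bad : Finset α → Prop} (hBad : bprob V q Bad ≤ ε * (1 - x) ^ J.card)
    {d : ℕ} (hd : ∀ a ∈ V, ∃ N : Finset ι, N.card ≤ d ∧ ∀ j ∈ J, a ∈ W j → j ∈ N) :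
    ∃ ν : PMF (Finset α), (∀ S, ν S ≠ 0 → S ⊆ V ∧ (∀ j ∈ J, ¬ A j S) ∧ ¬ Bad S) ∧
      ∀ T ⊆ V, (ν.toOuterMeasure {S | T ⊆ S}).toReal ≤
        (q / ((1 - x) ^ d * (1 - ε))) ^ T.card := by
  classical
  have hx' : 0 < 1 - x := by linarith
  have hε' : 0 < 1 - ε := by linarith
  set P := bprob V q (fun S => ∀ j ∈ J, ¬ A j S) with hP
  have hPlow : (1 - x) ^ J.card ≤ P := by
    have := pow_mul_bprob_le_bprob_union hq0 hq1 hx.le h (Finset.empty_subset J)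
      (Finset.Subset.refl J)
    have h1 : bprob V q (fun S => ∀ j ∈ (∅ : Finset ι), ¬ A j S) = 1 := by
      simp [bprob, bexp_const]
    rwa [h1, mul_one, Finset.empty_union] at this
  have hP0 : 0 < P := lt_of_lt_of_le (by positivity) hPlow
  have hgood : (1 - ε) * P ≤ bprob V q (fun S => (∀ j ∈ J, ¬ A j S) ∧ ¬ Bad S) := by
    have h1 := bprob_and_add_and_not V q (fun S => ∀ j ∈ J, ¬ A j S) Bad
    have h2 : bprob V q (fun S => (∀ j ∈ J, ¬ A j S) ∧ Bad S) ≤ bprob V q Bad :=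
      bprob_mono hq0 hq1 fun S _ h => h.2
    have h3 := mul_le_mul_of_nonneg_left hPlow hε0
    rw [← hP] at h1
    linarith
  have hgood0 : 0 < bprob V q (fun S => (∀ j ∈ J, ¬ A j S) ∧ ¬ Bad S) :=
    lt_of_lt_of_le (by positivity) hgood
  obtain ⟨ν, hν, hprob⟩ := exists_pmf_conditioned hq0 hq1 hgood0
  refine ⟨ν, hν, fun T hT => ?_⟩
  rw [hprob]
  rcases T.eq_empty_or_nonempty with rfl | hTne
  · simp [div_self hgood0.ne']
  set K := J.filter (fun j => Disjoint T (W j)) with hK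
  set K' := J.filter (fun j => ¬ Disjoint T (W j)) with hK'
  have hKK : K ∪ K' = J := Finset.filter_union_filter_not_eq _ _
  have hcard : K'.card ≤ d * T.card := by
    choose! N hN hN' using hd
    calc K'.card ≤ (T.biUnion N).card := Finset.card_le_card fun j hj => by
          obtain ⟨hjJ, hjT⟩ := Finset.mem_filter.1 hj
          obtain ⟨a, haT, haW⟩ := Finset.not_disjoint_iff.1 hjT
          exact Finset.mem_biUnion.2 ⟨a, haT, hN' a (hT haT) j hjJ haW⟩
      _ ≤ ∑ a ∈ T, (N a).card := Finset.card_biUnion_le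
      _ ≤ ∑ _a ∈ T, d := Finset.sum_le_sum fun a ha => hN a (hT ha)
      _ = d * T.card := by rw [Finset.sum_const, smul_eq_mul, mul_comm]
  have h1 : bprob V q (fun S => T ⊆ S ∧ (∀ j ∈ J, ¬ A j S) ∧ ¬ Bad S) ≤
      q ^ T.card * bprob V q (fun S => ∀ j ∈ K, ¬ A j S) := by
    rw [← bprob_superset hT, ← bprob_and_of_disjoint V q T]
    · exact bprob_mono hq0 hq1 fun S _ h =>
        ⟨h.1, fun j hj => h.2.1 j (Finset.mem_filter.1 hj).1⟩
    · exact fun S => ⟨fun h => Finset.subset_inter h subset_rfl,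
        fun h => h.trans Finset.inter_subset_left⟩
    · refine fun S => forall₂_congr fun j hj => not_congr ?_
      obtain ⟨hjJ, hdj⟩ := Finset.mem_filter.1 hj
      refine hA j hjJ _ _ ?_
      ext y
      simp only [Finset.mem_inter, Finset.mem_sdiff]
      have h₂ : y ∈ W j → y ∉ T := fun h => Finset.disjoint_right.1 hdj h
      tauto
  have h2 := pow_mul_bprob_le_bprob_union hq0 hq1 hx.le h (K := K) (K' := K')
    (Finset.filter_subset _ _) (Finset.filter_subset _ _)
  rw [hKK, ← hP] at h2
  have h3 : ((1 - x) ^ d) ^ T.card ≤ (1 - x) ^ K'.card := by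
    rw [← pow_mul]
    exact pow_le_pow_of_le_one hx'.le (by linarith) hcard
  have h4 : (1 - ε) ^ T.card ≤ 1 - ε :=
    pow_le_of_le_one hε'.le (by linarith) (Finset.card_pos.2 hTne).ne'
  have hnn := bprob_nonneg (V := V) hq0 hq1 (fun S => ∀ j ∈ K, ¬ A j S)
  rw [div_pow, div_le_div_iff₀ hgood0 (by positivity), mul_pow]
  calc _ ≤ (q ^ T.card * bprob V q (fun S => ∀ j ∈ K, ¬ A j S)) *
        ((1 - x) ^ K'.card * (1 - ε)) := by gcongr
    _ = q ^ T.card * ((1 - ε) *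
        ((1 - x) ^ K'.card * bprob V q (fun S => ∀ j ∈ K, ¬ A j S))) := by ring
    _ ≤ q ^ T.card * ((1 - ε) * P) := by gcongr
    _ ≤ _ := by gcongr

end RandomSubset

section Lines

theorem grid2_finite (n : ℕ) : (grid2 n).Finite := by
  refine ((Set.finite_Icc (1 : ℤ) n).prod (Set.finite_Icc (1 : ℤ) n)).image
    (fun p : ℤ × ℤ => ((p.1 : ℝ), (p.2 : ℝ))) |>.subset ?_
  rintro p ⟨a, b, ha, ha', hb, hb', rfl⟩
  exact ⟨(a, b), ⟨⟨ha, ha'⟩, ⟨hb, hb'⟩⟩, rfl⟩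

/-- Pigeonhole principle on a real-valued coordinate. -/
theorem exists_ne_abs_sub_lt {β : Type*} (s : Finset β) (g : β → ℝ) (n W : ℕ) (hn : 0 < n)
    (hg : ∀ x ∈ s, 1 ≤ g x ∧ g x ≤ n) (hW : n ≤ W * (s.card - 1)) :
    ∃ x ∈ s, ∃ y ∈ s, x ≠ y ∧ |g x - g y| < W := by
  have hW0 : 0 < W := Nat.pos_of_mul_pos_right (lt_of_lt_of_le hn hW)
  have hs : 0 < s.card - 1 := Nat.pos_of_mul_pos_left (lt_of_lt_of_le hn hW)
  have hW0' : (0 : ℝ) < W := by exact_mod_cast hW0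
  have hW' : (n : ℝ) ≤ W * ((s.card - 1 : ℕ) : ℝ) := by exact_mod_cast hW
  obtain ⟨x, hx, y, hy, hxy, he⟩ := Finset.exists_ne_map_eq_of_card_lt_of_maps_to
    (s := s) (t := Finset.range (s.card - 1)) (f := fun x => ⌊(g x - 1) / W⌋₊)
    (by rw [Finset.card_range]; omega)
    (fun x hx => by
      have := hg x hx
      simp only [Finset.coe_range, Set.mem_Iio]
      rw [Nat.floor_lt (div_nonneg (by linarith) hW0'.le), div_lt_iff₀ hW0']
      linarith)
  refine ⟨x, hx, y, hy, hxy, ?_⟩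
  have hx0 : 0 ≤ (g x - 1) / W := div_nonneg (by linarith [hg x hx]) hW0'.le
  have hy0 : 0 ≤ (g y - 1) / W := div_nonneg (by linarith [hg y hy]) hW0'.le
  have h1 := Nat.floor_le hx0
  have h2 := Nat.lt_floor_add_one ((g x - 1) / W)
  have h3 := Nat.floor_le hy0
  have h4 := Nat.lt_floor_add_one ((g y - 1) / W)
  rw [he] at h1 h2
  have h5 : (g x - 1) / W - (g y - 1) / W < 1 := by linarith
  have h6 : (g y - 1) / W - (g x - 1) / W < 1 := by linarith
  rw [← sub_div, div_lt_one hW0'] at h5 h6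
  rw [abs_lt]
  constructor <;> linarith

/-- A line containing many grid points contains two distinct ones that are close. -/
theorem IsLine.exists_close_grid_points {n : ℕ} (hn : 0 < n) {L : AffineSubspace ℝ (ℝ × ℝ)}
    (hL : IsLine L) {W : ℕ}
    (hW : n ≤ W * ((grid2 n ∩ (L : Set (ℝ × ℝ))).ncard - 1)) :
    ∃ P ∈ grid2 n ∩ (L : Set (ℝ × ℝ)), ∃ Q ∈ grid2 n ∩ (L : Set (ℝ × ℝ)), P ≠ Q ∧
      |P.1 - Q.1| < W ∧ |P.2 - Q.2| < W := by
  obtain ⟨⟨v, hv⟩, -, hspan⟩ := finrank_eq_one_iff'.1 hL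
  have hfin : (grid2 n ∩ (L : Set (ℝ × ℝ))).Finite := (grid2_finite n).inter_of_left _
  rw [Set.ncard_eq_toFinset_card _ hfin] at hW
  have hdiff : ∀ P ∈ L, ∀ Q ∈ L, ∃ c : ℝ, P.1 - Q.1 = c * v.1 ∧ P.2 - Q.2 = c * v.2 := by
    intro P hP Q hQ
    obtain ⟨c, hc⟩ := hspan ⟨P -ᵥ Q, AffineSubspace.vsub_mem_direction hP hQ⟩
    have hc' : c • v = P - Q := congrArg Subtype.val hc
    refine ⟨c, ?_, ?_⟩
    · simpa using (congrArg Prod.fst hc').symm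
    · simpa using (congrArg Prod.snd hc').symm
  rcases le_total |v.2| |v.1| with h | h
  · obtain ⟨P, hP, Q, hQ, hne, hlt⟩ := exists_ne_abs_sub_lt hfin.toFinset Prod.fst n W hn
      (fun P hP => by
        obtain ⟨⟨a, b, h1, h2, h3, h4, rfl⟩, -⟩ := hfin.mem_toFinset.1 hP
        dsimp only
        exact ⟨by exact_mod_cast h1, by exact_mod_cast h2⟩) hW
    rw [hfin.mem_toFinset] at hP hQ
    refine ⟨P, hP, Q, hQ, hne, hlt, lt_of_le_of_lt ?_ hlt⟩
    obtain ⟨c, h1, h2⟩ := hdiff P hP.2 Q hQ.2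
    rw [h1, h2, abs_mul, abs_mul]
    gcongr
  · obtain ⟨P, hP, Q, hQ, hne, hlt⟩ := exists_ne_abs_sub_lt hfin.toFinset Prod.snd n W hn
      (fun P hP => by
        obtain ⟨⟨a, b, h1, h2, h3, h4, rfl⟩, -⟩ := hfin.mem_toFinset.1 hP
        dsimp only
        exact ⟨by exact_mod_cast h3, by exact_mod_cast h4⟩) hW
    rw [hfin.mem_toFinset] at hP hQ
    refine ⟨P, hP, Q, hQ, hne, lt_of_le_of_lt ?_ hlt, hlt⟩
    obtain ⟨c, h1, h2⟩ := hdiff P hP.2 Q hQ.2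
    rw [h1, h2, abs_mul, abs_mul]
    gcongr

/-- Few lines through a given point contain many grid points. -/
theorem exists_finset_rich_lines_through {n : ℕ} (hn : 0 < n) (W : ℕ) (p : ℝ × ℝ) :
    ∃ N : Finset (AffineSubspace ℝ (ℝ × ℝ)), N.card ≤ (2 * W + 1) ^ 2 ∧
      ∀ L, IsLine L → p ∈ L → n ≤ W * ((grid2 n ∩ (L : Set (ℝ × ℝ))).ncard - 1) → L ∈ N := by
  classical
  refine ⟨(Finset.Icc (-(W : ℤ)) W ×ˢ Finset.Icc (-(W : ℤ)) W).image fun z =>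
    AffineSubspace.mk' p (ℝ ∙ (((z.1 : ℝ), (z.2 : ℝ)) : ℝ × ℝ)), ?_, fun L hL hp hW => ?_⟩
  · refine Finset.card_image_le.trans ?_
    rw [Finset.card_product, Int.card_Icc, sq]
    have : ((W : ℤ) + 1 - -(W : ℤ)).toNat = 2 * W + 1 := by omega
    rw [this]
  · obtain ⟨P, hP, Q, hQ, hne, h1, h2⟩ := hL.exists_close_grid_points hn hW
    have hmem : P -ᵥ Q ∈ L.direction := AffineSubspace.vsub_mem_direction hP.2 hQ.2
    obtain ⟨a, b, -, -, -, -, rfl⟩ := hP.1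
    obtain ⟨a', b', -, -, -, -, rfl⟩ := hQ.1
    simp only at h1 h2
    have h1' : |a - a'| < (W : ℤ) := by exact_mod_cast h1
    have h2' : |b - b'| < (W : ℤ) := by exact_mod_cast h2
    rw [abs_lt] at h1' h2'
    refine Finset.mem_image.2 ⟨(a - a', b - b'), ?_, ?_⟩
    · simp only [Finset.mem_product, Finset.mem_Icc]
      omega
    · have hv : (((a : ℝ), (b : ℝ)) -ᵥ ((a' : ℝ), (b' : ℝ)) : ℝ × ℝ) =
          (((a - a' : ℤ) : ℝ), ((b - b' : ℤ) : ℝ)) := by simp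
      rw [hv] at hmem
      have hv0 : ((((a - a' : ℤ) : ℝ), ((b - b' : ℤ) : ℝ)) : ℝ × ℝ) ≠ 0 := by
        rw [← hv]; exact vsub_ne_zero.2 hne
      have hdir : (ℝ ∙ ((((a - a' : ℤ) : ℝ), ((b - b' : ℤ) : ℝ)) : ℝ × ℝ)) = L.direction := by
        have : Module.Finite ℝ L.direction := Module.finite_of_finrank_eq_succ hL
        refine Submodule.eq_of_le_of_finrank_eq
          ((Submodule.span_singleton_le_iff_mem _ _).2 hmem) ?_
        rw [finrank_span_singleton hv0]
        exact hL.symm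
      simp only
      rw [hdir]
      exact AffineSubspace.mk'_eq hp

end Lines

/-- Being `v ^ 12`-nice, expressed through integer powers of `v`. -/
theorem isNice_pow_iff {n : ℕ} {v : ℝ} (hv : 0 < v) (S : Set (ℝ × ℝ)) :
    IsNice n (v ^ 12) S ↔
      S ⊆ grid2 n ∧
      (∀ L : AffineSubspace ℝ (ℝ × ℝ), InLines n L →
        1 / v ^ 8 < lineWeight n L → lineWeight n L ≤ 1 →
        (1 - 1 / v) * v ^ 12 * lineWeight n L ≤ ((S ∩ (L : Set (ℝ × ℝ))).ncard : ℝ) ∧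
        ((S ∩ (L : Set (ℝ × ℝ))).ncard : ℝ) ≤ (1 + 1 / v) * v ^ 12 * lineWeight n L) ∧
      (∀ L : AffineSubspace ℝ (ℝ × ℝ), InLines n L →
        1 / v ^ 24 < lineWeight n L → lineWeight n L ≤ 1 / v ^ 8 →
        ((S ∩ (L : Set (ℝ × ℝ))).ncard : ℝ) ≤ (1 + 1 / v) * v ^ 4) ∧
      (∀ L : AffineSubspace ℝ (ℝ × ℝ), InLines n L →
        lineWeight n L ≤ 1 / v ^ 24 → (S ∩ (L : Set (ℝ × ℝ))).ncard ≤ 14) ∧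
      (∀ I J : Finset ℤ, ↑I ⊆ Set.Icc (1 : ℤ) (n : ℤ) → ↑J ⊆ Set.Icc (1 : ℤ) (n : ℤ) →
        (n : ℝ) / 10 ≤ I.card → (n : ℝ) / 10 ≤ J.card →
        (1 - 1 / v) * I.card * J.card * v ^ 12 / n ≤ ((S ∩ gridRect I J).ncard : ℝ) ∧
        ((S ∩ gridRect I J).ncard : ℝ) ≤ (1 + 1 / v) * I.card * J.card * v ^ 12 / n) := by
  have key : ∀ (r : ℝ) (k : ℕ), 12 * r = -k → (v ^ 12) ^ r = 1 / v ^ k := by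
    intro r k h
    rw [← Real.rpow_natCast v 12, ← Real.rpow_mul hv.le]
    have : ((12 : ℕ) : ℝ) * r = -k := by exact_mod_cast h
    rw [this, Real.rpow_neg hv.le, Real.rpow_natCast, one_div]
  have h1 := key (-(2 : ℝ) / 3) 8 (by norm_num)
  have h2 := key (-(2 : ℝ)) 24 (by norm_num)
  have h3 := key (-(1 : ℝ) / 12) 1 (by norm_num)
  have h4 : (v ^ 12) ^ ((1 : ℝ) / 3) = v ^ 4 := by
    rw [← Real.rpow_natCast v 12, ← Real.rpow_mul hv.le, ← Real.rpow_natCast v 4]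
    norm_num
  rw [pow_one] at h3
  unfold IsNice
  rw [h1, h2, h3, h4]

section Numerics

variable {u : ℝ}

theorem two_mul_exp_neg_sq_le (hu : 1000 ≤ u) :
    2 * Real.exp (-(u ^ 2 / 9)) ≤ 1 / (10 ^ 10 * u ^ 180) := by
  have hu0 : 0 < u := by linarith
  have h1 : (2 / 5 * u) ^ 250 ≤ Real.exp (u ^ 2 / 9) := by
    calc (2 / 5 * u) ^ 250 ≤ Real.exp (u ^ 2 / 2250) ^ 250 := by
          refine pow_le_pow_left₀ (by positivity) ?_ _
          have := Real.add_one_le_exp (u ^ 2 / 2250)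
          nlinarith
      _ = Real.exp (u ^ 2 / 9) := by rw [← Real.exp_nat_mul]; congr 1; push_cast; ring
  have h2 : (2 : ℝ) * (10 ^ 10 * u ^ 180) ≤ (2 / 5 * u) ^ 250 := by
    have h3 : (1000 : ℝ) ^ 70 ≤ u ^ 70 := pow_le_pow_left₀ (by norm_num) hu _
    have h4 : (2 / 5 * u) ^ 250 = (2 / 5) ^ 250 * u ^ 70 * u ^ 180 := by ring
    have h5 : (2 : ℝ) * 10 ^ 10 ≤ (2 / 5) ^ 250 * u ^ 70 :=
      le_trans (by norm_num) (mul_le_mul_of_nonneg_left h3 (by positivity))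
    rw [h4]
    nlinarith [mul_le_mul_of_nonneg_right h5 (pow_nonneg hu0.le 180)]
  rw [Real.exp_neg, ← div_eq_mul_inv, div_le_div_iff₀ (Real.exp_pos _) (by positivity)]
  linarith

theorem exp_neg_div_le (hu : 1000 ≤ u) {M : ℝ} (hM : u ^ 4 ≤ M) :
    2 * Real.exp (-(M / (9 * u ^ 2))) ≤ 1 / (10 ^ 10 * u ^ 180) := by
  refine le_trans ?_ (two_mul_exp_neg_sq_le hu)
  have hu0 : 0 < u := by linarith
  have : u ^ 2 / 9 ≤ M / (9 * u ^ 2) := by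
    rw [div_le_div_iff₀ (by norm_num) (by positivity)]; nlinarith
  gcongr

theorem exp_neg_two_mul_le {x : ℝ} (hx0 : 0 ≤ x) (hx : x ≤ 1 / 2) :
    Real.exp (-(2 * x)) ≤ 1 - x := by
  have h := Real.add_one_le_exp (2 * x)
  rw [Real.exp_neg, inv_le_comm₀ (Real.exp_pos _) (by linarith)]
  refine le_trans ?_ h
  rw [inv_le_iff_one_le_mul₀ (by linarith)]
  nlinarith

/-- The probability that `15` points are chosen from a set of small expected size. -/
theorem bprob_fourteen_lt_card_inter_le {α : Type*} [DecidableEq α] {V : Finset α} {q : ℝ}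
    (hq0 : 0 ≤ q) (hq1 : q ≤ 1) (B : Finset α) (hB : B ⊆ V)
    (hu : 1000 ≤ u) (hK : q * B.card ≤ (1 + 1 / u ^ 3) / u ^ 12) :
    bprob V q (fun S => 14 < (S ∩ B).card) ≤ 1 / (10 ^ 10 * u ^ 180) := by
  have hu0 : 0 < u := by linarith
  set c : ℝ := 10 * u ^ 12 with hc
  have hc0 : 0 < c := by positivity
  have hu12 : 1 ≤ u ^ 12 := one_le_pow₀ (by linarith)
  have hu3 : 1 ≤ u ^ 3 := one_le_pow₀ (by linarith)
  have hu3' : 1000 ^ 3 ≤ u ^ 3 := pow_le_pow_left₀ (by norm_num) hu _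
  have hc1 : 1 ≤ c := by linarith
  have h1 : bprob V q (fun S => 14 < (S ∩ B).card) ≤
      bexp V q (fun S => (c ^ 15)⁻¹ * c ^ (S ∩ B).card) := by
    refine bprob_le_bexp hq0 hq1 (fun S => by positivity) fun S _ h => ?_
    rw [inv_mul_eq_div, one_le_div (by positivity)]
    exact pow_le_pow_right₀ hc1 h
  refine h1.trans ?_
  rw [bexp_const_mul]
  have h2 : Real.exp (q * B.card * (c - 1)) ≤ 10 ^ 5 := by
    have h3 : q * B.card * (c - 1) ≤ 11 := by
      calc q * B.card * (c - 1) ≤ (1 + 1 / u ^ 3) / u ^ 12 * c :=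
            mul_le_mul hK (by linarith) (by linarith) (by positivity)
        _ = 10 * (1 + 1 / u ^ 3) := by rw [hc]; field_simp
        _ ≤ 11 := by
          have : 1 / u ^ 3 ≤ 1 / 10 := by
            rw [div_le_div_iff₀ (by positivity) (by norm_num)]; linarith
          linarith
    refine (Real.exp_le_exp.2 h3).trans ?_
    have h4 : Real.exp 11 = Real.exp 1 ^ 11 := by rw [← Real.exp_nat_mul]; norm_num
    rw [h4]
    exact (pow_le_pow_left₀ (Real.exp_nonneg _) Real.exp_one_lt_d9.le 11).trans (by norm_num)
  calc (c ^ 15)⁻¹ * bexp V q (fun S => c ^ (S ∩ B).card)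
      ≤ (c ^ 15)⁻¹ * 10 ^ 5 := by
        gcongr
        exact (bexp_pow_card_inter_le hq0 hq1 B hB hc0.le).trans h2
    _ = 1 / (10 ^ 10 * u ^ 180) := by rw [hc]; field_simp

end Numerics

theorem bprob_or_le {α : Type*} [DecidableEq α] {V : Finset α} {q : ℝ}
    (hq0 : 0 ≤ q) (hq1 : q ≤ 1) (A B : Finset α → Prop) :
    bprob V q (fun S => A S ∨ B S) ≤ bprob V q A + bprob V q B := by
  rw [← bprob_and_add_and_not V q (fun S => A S ∨ B S) A]
  exact add_le_add (bprob_mono hq0 hq1 fun S _ h => h.2)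
    (bprob_mono hq0 hq1 fun S _ h => h.1.resolve_left h.2)

/-- Two-sided Chernoff bound. -/
theorem bprob_card_inter_deviation_le {α : Type*} [DecidableEq α] {V : Finset α} {q : ℝ}
    (hq0 : 0 ≤ q) (hq1 : q ≤ 1) (B : Finset α) (hB : B ⊆ V) {u M : ℝ} (hu : 10 ≤ u)
    (hM : 0 ≤ M) (hK : (1 - 1 / u ^ 3) * M ≤ q * B.card)
    (hK' : q * B.card ≤ (1 + 1 / u ^ 3) * M) :
    bprob V q (fun S => (1 + 1 / u) * M < (S ∩ B).card ∨ (S ∩ B).card < (1 - 1 / u) * M) ≤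
      2 * Real.exp (-(M / (9 * u ^ 2))) := by
  have h1 := bprob_card_inter_gt_le hq0 hq1 B hB hu hM hK'
  have h2 := bprob_card_inter_lt_le hq0 hq1 B hB hu hM hK
  have h3 := bprob_or_le (V := V) hq0 hq1 (fun S => (1 + 1 / u) * M < (S ∩ B).card)
    (fun S => (S ∩ B).card < (1 - 1 / u) * M)
  linarith

/-- The number `k` of chosen points on a line of weight `w` violates the requirements on a
`u ^ 12`-nice set. -/
def IsLineCountBad (u w : ℝ) (k : ℕ) : Prop :=
  (1 / u ^ 8 < w ∧ ((1 + 1 / u) * (u ^ 12 * w) < k ∨ k < (1 - 1 / u) * (u ^ 12 * w))) ∨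
  (1 / u ^ 24 < w ∧ w ≤ 1 / u ^ 8 ∧ (1 + 1 / u) * u ^ 4 < k) ∨
  (w ≤ 1 / u ^ 24 ∧ 14 < k)

theorem bprob_isLineCountBad_le {α : Type*} [DecidableEq α] {V : Finset α} {u w : ℝ}
    (hu : 1000 ≤ u) (B : Finset α) (hB : B ⊆ V)
    (hheavy : 1 / u ^ 24 < w → (1 - 1 / u ^ 3) * (u ^ 36 * w) ≤ B.card ∧
      B.card ≤ (1 + 1 / u ^ 3) * (u ^ 36 * w))
    (hlight : w ≤ 1 / u ^ 24 → B.card ≤ (1 + 1 / u ^ 3) * u ^ 12) :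
    bprob V (1 / u ^ 24) (fun S => IsLineCountBad u w (S ∩ B).card) ≤
      1 / (10 ^ 10 * u ^ 180) := by
  have hu0 : 0 < u := by linarith
  have hq0 : 0 ≤ 1 / u ^ 24 := by positivity
  have hq1 : 1 / u ^ 24 ≤ 1 := by
    rw [div_le_one (by positivity)]; exact one_le_pow₀ (by linarith)
  have h824 : 1 / u ^ 24 ≤ 1 / u ^ 8 :=
    one_div_le_one_div_of_le (by positivity) (pow_le_pow_right₀ (by linarith) (by norm_num))
  rcases le_or_gt w (1 / u ^ 24) with h24 | h24
  · refine le_trans (bprob_mono hq0 hq1 fun S _ h => ?_)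
      (bprob_fourteen_lt_card_inter_le hq0 hq1 B hB hu ?_)
    · rcases h with h | h | h
      · linarith [h.1]
      · linarith [h.1]
      · exact h.2
    · calc 1 / u ^ 24 * B.card ≤ 1 / u ^ 24 * ((1 + 1 / u ^ 3) * u ^ 12) := by
            gcongr; exact hlight h24
        _ = _ := by field_simp
  obtain ⟨hlow, hup⟩ := hheavy h24
  have hlow' : (1 - 1 / u ^ 3) * (u ^ 12 * w) ≤ 1 / u ^ 24 * B.card := by
    calc _ = 1 / u ^ 24 * ((1 - 1 / u ^ 3) * (u ^ 36 * w)) := by field_simp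
      _ ≤ _ := by gcongr
  have hup' : 1 / u ^ 24 * B.card ≤ (1 + 1 / u ^ 3) * (u ^ 12 * w) := by
    calc _ ≤ 1 / u ^ 24 * ((1 + 1 / u ^ 3) * (u ^ 36 * w)) := by gcongr
      _ = _ := by field_simp
  have hw0 : 0 ≤ w := hq0.trans h24.le
  rcases le_or_gt w (1 / u ^ 8) with h8 | h8
  · have hw : u ^ 12 * w ≤ u ^ 4 := by
      calc u ^ 12 * w ≤ u ^ 12 * (1 / u ^ 8) := by gcongr
        _ = u ^ 4 := by field_simp
    refine le_trans (bprob_mono hq0 hq1 fun S _ h => ?_)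
      ((bprob_card_inter_gt_le hq0 hq1 B hB (u := u) (by linarith) (pow_nonneg hu0.le 4)
        (hup'.trans (by gcongr))).trans ?_)
    · rcases h with h | h | h
      · linarith [h.1]
      · exact h.2.2
      · linarith [h.1]
    · have := exp_neg_div_le hu (le_refl (u ^ 4))
      linarith [Real.exp_pos (-(u ^ 4 / (9 * u ^ 2)))]
  · have hw : u ^ 4 ≤ u ^ 12 * w := by
      calc u ^ 4 = u ^ 12 * (1 / u ^ 8) := by field_simp
        _ ≤ u ^ 12 * w := by gcongr
    refine le_trans (bprob_mono hq0 hq1 fun S _ h => ?_)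
      ((bprob_card_inter_deviation_le hq0 hq1 B hB (by linarith) (by positivity) hlow'
        hup').trans (exp_neg_div_le hu hw))
    rcases h with h | h | h
    · exact h.2
    · linarith [h.2.1]
    · linarith [h.1]

theorem ncard_coe_inter_eq {α : Type*} [DecidableEq α] {S V : Finset α} (h : S ⊆ V) (Z : Set α)
    [DecidablePred (· ∈ Z)] : ((S : Set α) ∩ Z).ncard = (S ∩ V.filter (· ∈ Z)).card := by
  rw [← Set.ncard_coe_finset]
  congr 1
  ext x
  simp only [Set.mem_inter_iff, Finset.mem_coe, Finset.mem_inter, Finset.mem_filter]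
  exact ⟨fun hx => ⟨hx.1, h hx.1, hx.2⟩, fun hx => ⟨hx.1, hx.2.2⟩⟩

/-- The number `k` of chosen points in a rectangle `I × J` violates the requirements on a
`u ^ 12`-nice set. -/
def IsRectCountBad (n : ℕ) (u : ℝ) (I J : Finset ℤ) (k : ℕ) : Prop :=
  (n : ℝ) / 10 ≤ I.card ∧ (n : ℝ) / 10 ≤ J.card ∧
    ((1 + 1 / u) * (I.card * J.card * u ^ 12 / n) < k ∨
      k < (1 - 1 / u) * (I.card * J.card * u ^ 12 / n))

theorem bprob_isRectCountBad_le {α : Type*} [DecidableEq α] {V : Finset α} {n : ℕ} (hn : 0 < n)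
    {u : ℝ} (hu : 1000 ≤ u) (I J : Finset ℤ) (B : Finset α) (hB : B ⊆ V)
    (h : (n : ℝ) / 10 ≤ I.card → (n : ℝ) / 10 ≤ J.card →
      (1 - 1 / u ^ 3) * (I.card * J.card * u ^ 36 / n) ≤ B.card ∧
      B.card ≤ (1 + 1 / u ^ 3) * (I.card * J.card * u ^ 36 / n)) :
    bprob V (1 / u ^ 24) (fun S => IsRectCountBad n u I J (S ∩ B).card) ≤
      2 * Real.exp (-(100 * n)) := by
  have hu0 : 0 < u := by linarith
  have hq0 : 0 ≤ 1 / u ^ 24 := by positivity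
  have hq1 : 1 / u ^ 24 ≤ 1 := by
    rw [div_le_one (by positivity)]; exact one_le_pow₀ (by linarith)
  have hn0 : (0 : ℝ) < n := by exact_mod_cast hn
  by_cases hI : (n : ℝ) / 10 ≤ I.card
  swap
  · rw [bprob_eq_zero fun S _ h => hI h.1]; positivity
  by_cases hJ : (n : ℝ) / 10 ≤ J.card
  swap
  · rw [bprob_eq_zero fun S _ h => hJ h.2.1]; positivity
  obtain ⟨hlow, hup⟩ := h hI hJ
  refine le_trans (bprob_mono hq0 hq1 fun S _ h => h.2.2)
    ((bprob_card_inter_deviation_le hq0 hq1 B hB (by linarith) (by positivity) ?_ ?_).trans ?_)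
  · calc _ = 1 / u ^ 24 * ((1 - 1 / u ^ 3) * (I.card * J.card * u ^ 36 / n)) := by field_simp
      _ ≤ _ := by gcongr
  · calc _ ≤ 1 / u ^ 24 * ((1 + 1 / u ^ 3) * (I.card * J.card * u ^ 36 / n)) := by gcongr
      _ = _ := by field_simp
  · have h10 : (1000 : ℝ) ^ 10 ≤ u ^ 10 := pow_le_pow_left₀ (by norm_num) hu _
    have h1 : 100 * (n : ℝ) ≤ I.card * J.card * u ^ 12 / n / (9 * u ^ 2) := by
      calc 100 * (n : ℝ) ≤ n / 10 * (n / 10) * u ^ 12 / n / (9 * u ^ 2) := by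
            have : (n : ℝ) / 10 * (n / 10) * u ^ 12 / n / (9 * u ^ 2) = n * (u ^ 10 / 900) := by
              field_simp; norm_num
            rw [this]
            have : (100 : ℝ) ≤ u ^ 10 / 900 := by linarith
            nlinarith
        _ ≤ _ := by gcongr
    gcongr

theorem le_mul_of_lt_lineWeight {n : ℕ} {u : ℝ} (hu : 1 ≤ u)
    {L : AffineSubspace ℝ (ℝ × ℝ)} (hL : InLines n L) (hn : 0 < n)
    (hw : 1 / u ^ 72 < lineWeight n L) :
    n ≤ ⌈2 * u ^ 72⌉₊ * ((grid2 n ∩ (L : Set (ℝ × ℝ))).ncard - 1) := by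
  have hn0 : (0 : ℝ) < n := by exact_mod_cast hn
  have hu0 : 0 < u := by linarith
  obtain ⟨-, h2⟩ := hL
  unfold lineWeight at hw
  set k := (grid2 n ∩ (L : Set (ℝ × ℝ))).ncard
  have h2' : (2 : ℝ) ≤ k := by exact_mod_cast h2
  rw [div_lt_div_iff₀ (by positivity) hn0, one_mul] at hw
  have h3 : ((k - 1 : ℕ) : ℝ) = k - 1 := by rw [Nat.cast_sub (by omega)]; simp
  have h4 : (n : ℝ) ≤ ⌈2 * u ^ 72⌉₊ * ((k - 1 : ℕ) : ℝ) := by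
    calc (n : ℝ) ≤ 2 * u ^ 72 * (k - 1) := by nlinarith [pow_pos hu0 72]
      _ ≤ ⌈2 * u ^ 72⌉₊ * (k - 1) := by
        gcongr
        · linarith
        · exact Nat.le_ceil _
      _ = _ := by rw [h3]
  exact_mod_cast h4

theorem ceil_bound {u : ℝ} (hu : 1000 ≤ u) :
    (((2 * ⌈2 * u ^ 72⌉₊ + 1) ^ 2 : ℕ) : ℝ) ≤ 17 * u ^ 144 := by
  have h1 : (⌈2 * u ^ 72⌉₊ : ℝ) ≤ 2 * u ^ 72 + 1 := (Nat.ceil_lt_add_one (by positivity)).le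
  have h2 : (1000 : ℝ) ^ 72 ≤ u ^ 72 := pow_le_pow_left₀ (by norm_num) hu _
  have h3 : (1000 : ℝ) ≤ u ^ 72 := le_trans (by norm_num) h2
  push_cast
  calc (2 * (⌈2 * u ^ 72⌉₊ : ℝ) + 1) ^ 2 ≤ (2 * (2 * u ^ 72 + 1) + 1) ^ 2 := by gcongr
    _ ≤ 17 * (u ^ 72) ^ 2 := by nlinarith
    _ = 17 * u ^ 144 := by ring

/-- The parameter estimate for the spread constant. -/
theorem spread_ratio_le {u : ℝ} (hu : 1000 ≤ u) {d : ℕ} (hd : (d : ℝ) ≤ 17 * u ^ 144) :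
    1 / u ^ 24 / ((1 - 2 * (1 / (10 ^ 10 * u ^ 180))) ^ d * (1 - 1 / u ^ 36)) ≤
      (u ^ 12 + 1) / (u ^ 36 + 1) := by
  have hu0 : 0 < u := by linarith
  have h12 : (1000 : ℝ) ^ 12 ≤ u ^ 12 := pow_le_pow_left₀ (by norm_num) hu _
  have h12' : (1000 : ℝ) ≤ u ^ 12 := le_trans (by norm_num) h12
  have h36 : (1000 : ℝ) ≤ u ^ 36 :=
    h12'.trans (pow_le_pow_right₀ (by linarith) (by norm_num))
  have h180 : (1 : ℝ) ≤ u ^ 180 := one_le_pow₀ (by linarith)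
  set e := 1 / u ^ 36 with he
  have he1 : e ≤ 1 / 1000 := one_div_le_one_div_of_le (by norm_num) h36
  have he0 : 0 < e := by positivity
  have h1 : 1 - e ≤ (1 - 2 * (1 / (10 ^ 10 * u ^ 180))) ^ d := by
    have h2 : 1 / (10 ^ 10 * u ^ 180) ≤ 1 := by
      rw [div_le_one (by positivity)]; linarith
    have h3 := one_add_mul_le_pow (a := -(2 * (1 / (10 ^ 10 * u ^ 180)))) (by linarith) d
    have h4 : (d : ℝ) * (2 * (1 / (10 ^ 10 * u ^ 180))) ≤ e := by
      calc (d : ℝ) * (2 * (1 / (10 ^ 10 * u ^ 180))) ≤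
            17 * u ^ 144 * (2 * (1 / (10 ^ 10 * u ^ 180))) := by gcongr
        _ = 34 / 10 ^ 10 * e := by rw [he]; field_simp; norm_num
        _ ≤ e := by nlinarith
    rw [← sub_eq_add_neg] at h3
    linarith
  have h5 : 0 < 1 - e := by linarith
  calc _ ≤ 1 / u ^ 24 / ((1 - e) * (1 - e)) := by gcongr
    _ ≤ _ := by
      rw [div_le_div_iff₀ (by positivity) (by positivity)]
      have h6 : 1 / u ^ 24 * (u ^ 36 + 1) = u ^ 12 + u ^ 12 * e := by rw [he]; field_simp
      have h7 : u ^ 12 * e ≤ 1 / 1000 := by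
        have : u ^ 12 * e = 1 / u ^ 24 := by rw [he]; field_simp
        rw [this]
        exact one_div_le_one_div_of_le (by norm_num)
          (h12'.trans (pow_le_pow_right₀ (by linarith) (by norm_num)))
      rw [h6]
      nlinarith

/-- The total probability of a bad rectangle is negligible. -/
theorem rect_union_bound {u : ℝ} (hu : 1000 ≤ u) {n N : ℕ} (hn : u ^ 36 ≤ n)
    (hN : (N : ℝ) ≤ 34 * n * u ^ 180) :
    (2 ^ n * 2 ^ n : ℝ) * (2 * Real.exp (-(100 * n))) ≤
      1 / u ^ 36 * (1 - 2 * (1 / (10 ^ 10 * u ^ 180))) ^ N := by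
  have hu0 : 0 < u := by linarith
  have h180 : (1 : ℝ) ≤ u ^ 180 := one_le_pow₀ (by linarith)
  have h36 : (1 : ℝ) ≤ u ^ 36 := one_le_pow₀ (by linarith)
  have h2 : (2 : ℝ) ≤ Real.exp 1 := by have := Real.add_one_le_exp (1 : ℝ); linarith
  have hl : (2 ^ n * 2 ^ n : ℝ) * (2 * Real.exp (-(100 * n))) ≤ Real.exp (1 - 98 * n) := by
    have h3 : (2 : ℝ) ^ n ≤ Real.exp n := by
      calc (2 : ℝ) ^ n ≤ Real.exp 1 ^ n := by gcongr
        _ = Real.exp n := by rw [← Real.exp_nat_mul, mul_one]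
    calc _ ≤ Real.exp n * Real.exp n * (Real.exp 1 * Real.exp (-(100 * n))) := by gcongr
      _ = _ := by rw [← Real.exp_add, ← Real.exp_add, ← Real.exp_add]; congr 1; ring
  set p := 1 / (10 ^ 10 * u ^ 180) with hp
  have hp0 : 0 < p := by positivity
  have hp1 : p ≤ 1 / 4 := one_div_le_one_div_of_le (by norm_num) (by linarith)
  have h4 : Real.exp (-n) ≤ (1 - 2 * p) ^ N := by
    calc Real.exp (-n) ≤ Real.exp (-(2 * (2 * p))) ^ N := by
          rw [← Real.exp_nat_mul, Real.exp_le_exp]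
          have : (N : ℝ) * (4 * p) ≤ n := by
            calc (N : ℝ) * (4 * p) ≤ 34 * n * u ^ 180 * (4 * p) := by gcongr
              _ = 136 / 10 ^ 10 * n := by rw [hp]; field_simp; ring
              _ ≤ n := by
                have : (0 : ℝ) ≤ n := Nat.cast_nonneg n
                linarith
          linarith
      _ ≤ _ := pow_le_pow_left₀ (Real.exp_nonneg _)
        (exp_neg_two_mul_le (by linarith) (by linarith)) _
  have h5 : Real.exp (-n) ≤ 1 / u ^ 36 := by
    rw [Real.exp_neg, ← one_div]
    refine one_div_le_one_div_of_le (by positivity) (hn.trans ?_)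
    have := Real.add_one_le_exp (n : ℝ); linarith
  calc _ ≤ Real.exp (1 - 98 * n) := hl
    _ ≤ Real.exp (-n) * Real.exp (-n) := by
      rw [← Real.exp_add, Real.exp_le_exp]; linarith
    _ ≤ _ := by gcongr

/-- Sparsifying one `u ^ 36`-nice set: a distribution on its `u ^ 12`-nice subsets in which every
given set is contained with the expected probability, up to a small factor. -/
theorem exists_pmf_nice_subsets {n : ℕ} (hn : 0 < n) {u : ℝ} (hu : 1000 ≤ u)
    (hun : u ^ 36 ≤ n) {V : Finset (ℝ × ℝ)} (hV : IsNice n (u ^ 36) (V : Set (ℝ × ℝ))) :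
    ∃ ν : PMF (Finset (ℝ × ℝ)), (∀ S, ν S ≠ 0 → S ⊆ V ∧ IsNice n (u ^ 12) (S : Set (ℝ × ℝ))) ∧
      ∀ T ⊆ V, (ν.toOuterMeasure {S | T ⊆ S}).toReal ≤
        ((u ^ 12 + 1) / (u ^ 36 + 1)) ^ T.card := by
  classical
  have hu0 : 0 < u := by linarith
  have hn0 : (0 : ℝ) < n := by exact_mod_cast hn
  rw [show u ^ 36 = (u ^ 3) ^ 12 by ring, isNice_pow_iff (by positivity)] at hV
  simp only [← pow_mul] at hV
  norm_num only at hV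
  obtain ⟨hVgrid, hV1, hV2, hV3, hV4⟩ := hV
  have hq0 : 0 ≤ 1 / u ^ 24 := by positivity
  have hq1 : 1 / u ^ 24 ≤ 1 := by
    rw [div_le_one (by positivity)]; exact one_le_pow₀ (by linarith)
  have hu3 : 1 / u ^ 3 ≤ 1 / 1000 := one_div_le_one_div_of_le (by norm_num)
    (hu.trans (le_self_pow₀ (by linarith) (by norm_num)))
  have h824 : 1 / u ^ 24 ≤ 1 / u ^ 8 :=
    one_div_le_one_div_of_le (by positivity) (pow_le_pow_right₀ (by linarith) (by norm_num))
  have h2472 : 1 / u ^ 72 ≤ 1 / u ^ 24 :=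
    one_div_le_one_div_of_le (by positivity) (pow_le_pow_right₀ (by linarith) (by norm_num))
  have h8 : 1 / u ^ 8 ≤ 1 := by
    rw [div_le_one (by positivity)]; exact one_le_pow₀ (by linarith)
  set W : AffineSubspace ℝ (ℝ × ℝ) → Finset (ℝ × ℝ) := fun L => V.filter (· ∈ (L : Set (ℝ × ℝ)))
    with hW
  set R : Finset ℤ × Finset ℤ → Finset (ℝ × ℝ) := fun z => V.filter (· ∈ gridRect z.1 z.2) with hR
  have hWV : ∀ L, W L ⊆ V := fun L => Finset.filter_subset _ _
  have hRV : ∀ z, R z ⊆ V := fun z => Finset.filter_subset _ _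
  have hWcard : ∀ L : AffineSubspace ℝ (ℝ × ℝ),
      ((V : Set (ℝ × ℝ)) ∩ (L : Set (ℝ × ℝ))).ncard = (W L).card := fun L =>
    (ncard_coe_inter_eq (Finset.Subset.refl V) _).trans
      (congrArg Finset.card (Finset.inter_eq_right.2 (hWV L)))
  have hRcard : ∀ I J : Finset ℤ,
      ((V : Set (ℝ × ℝ)) ∩ gridRect I J).ncard = (R (I, J)).card := fun I J =>
    (ncard_coe_inter_eq (Finset.Subset.refl V) _).trans
      (congrArg Finset.card (Finset.inter_eq_right.2 (hRV (I, J))))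
  simp only [hWcard, hRcard] at hV1 hV2 hV3 hV4
  -- lines through points of `V`
  set d : ℕ := (2 * ⌈2 * u ^ 72⌉₊ + 1) ^ 2 with hd
  have hdle : (d : ℝ) ≤ 17 * u ^ 144 := ceil_bound hu
  choose N hNcard hN using exists_finset_rich_lines_through hn ⌈2 * u ^ 72⌉₊
  set J : Finset (AffineSubspace ℝ (ℝ × ℝ)) := (V.biUnion N).filter
    (fun L => InLines n L ∧ 1 / u ^ 72 < lineWeight n L ∧ lineWeight n L ≤ 1) with hJ
  have hJN : ∀ L ∈ J, ∀ a ∈ W L, L ∈ N a := by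
    intro L hL a ha
    obtain ⟨-, h1, h2, -⟩ := Finset.mem_filter.1 hL
    exact hN a L h1.1 (Finset.mem_filter.1 ha).2
      (le_mul_of_lt_lineWeight (by linarith) h1 hn h2)
  have hJmem : ∀ L, InLines n L → 1 / u ^ 72 < lineWeight n L → lineWeight n L ≤ 1 →
      (W L).Nonempty → L ∈ J := by
    rintro L h1 h2 h3 ⟨a, ha⟩
    refine Finset.mem_filter.2 ⟨Finset.mem_biUnion.2 ⟨a, hWV L ha, ?_⟩, h1, h2, h3⟩
    exact hN a L h1.1 (Finset.mem_filter.1 ha).2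
      (le_mul_of_lt_lineWeight (by linarith) h1 hn h2)
  have hVcard : (V.card : ℝ) ≤ 2 * n * u ^ 36 := by
    have hc : (Finset.Icc (1 : ℤ) n).card = n := by simp
    have h1 := (hV4 (Finset.Icc 1 n) (Finset.Icc 1 n) (by simp) (by simp)
      (by rw [hc]; linarith) (by rw [hc]; linarith)).2
    have h2 : R (Finset.Icc 1 (n : ℤ), Finset.Icc 1 (n : ℤ)) = V := by
      refine Finset.filter_true_of_mem fun x hx => ?_
      obtain ⟨a, b, h1, h2, h3, h4, rfl⟩ := hVgrid hx
      exact ⟨a, Finset.mem_Icc.2 ⟨h1, h2⟩, b, Finset.mem_Icc.2 ⟨h3, h4⟩, rfl⟩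
    rw [h2, hc] at h1
    refine h1.trans ?_
    rw [div_le_iff₀ hn0]
    have : 0 ≤ (n : ℝ) * n * u ^ 36 := by positivity
    nlinarith
  have hJcard : (J.card : ℝ) ≤ 34 * n * u ^ 180 := by
    have h1 : J.card ≤ V.card * d := by
      refine (Finset.card_le_card (Finset.filter_subset _ _)).trans
        (Finset.card_biUnion_le.trans ?_)
      exact (Finset.sum_le_sum fun a _ => hNcard a).trans (by simp [hd])
    calc (J.card : ℝ) ≤ V.card * d := by exact_mod_cast h1
      _ ≤ 2 * n * u ^ 36 * (17 * u ^ 144) := by gcongr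
      _ = _ := by ring
  have hWheavy : ∀ L, InLines n L → 1 / u ^ 24 < lineWeight n L → lineWeight n L ≤ 1 →
      (1 - 1 / u ^ 3) * (u ^ 36 * lineWeight n L) ≤ (W L).card ∧
      ((W L).card : ℝ) ≤ (1 + 1 / u ^ 3) * (u ^ 36 * lineWeight n L) := by
    intro L h1 h2 h3
    simpa only [mul_assoc] using hV1 L h1 h2 h3
  have hWpos : ∀ L, InLines n L → 1 / u ^ 24 < lineWeight n L → lineWeight n L ≤ 1 →
      (W L).Nonempty := by
    intro L h1 h2 h3
    have hw : 0 < lineWeight n L := hq0.trans_lt h2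
    have h4 : 0 < (1 - 1 / u ^ 3) * (u ^ 36 * lineWeight n L) :=
      mul_pos (by linarith) (by positivity)
    have h5 := h4.trans_le (hWheavy L h1 h2 h3).1
    exact Finset.card_pos.1 (by exact_mod_cast h5)
  have hWle : ∀ L ∈ J, ((W L).card : ℝ) ≤ 2 * u ^ 36 := by
    intro L hL
    obtain ⟨-, h1, h2, h3⟩ := Finset.mem_filter.1 hL
    rcases le_or_gt (lineWeight n L) (1 / u ^ 24) with h | h
    · refine (hV2 L h1 h2 h).trans ?_
      have : u ^ 12 ≤ u ^ 36 := pow_le_pow_right₀ (by linarith) (by norm_num)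
      gcongr
      linarith
    · refine (hWheavy L h1 h h3).2.trans ?_
      have hw : 0 ≤ lineWeight n L := hq0.trans h.le
      exact mul_le_mul (by linarith) (mul_le_of_le_one_right (by positivity) h3) (by positivity)
        (by norm_num)
  -- the local events
  set A : AffineSubspace ℝ (ℝ × ℝ) → Finset (ℝ × ℝ) → Prop := fun L S =>
    IsLineCountBad u (lineWeight n L) (S ∩ W L).card with hA
  have hAdep : ∀ L ∈ J, ∀ S S', S ∩ W L = S' ∩ W L → (A L S ↔ A L S') := by
    intro L _ S S' h
    simp only [hA, h]
  set p : ℝ := 1 / (10 ^ 10 * u ^ 180) with hp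
  have hp0 : 0 < p := by positivity
  have hp1 : p ≤ 1 / 4 := one_div_le_one_div_of_le (by norm_num) (by
    have : (1 : ℝ) ≤ u ^ 180 := one_le_pow₀ (by linarith)
    linarith)
  have hAp : ∀ L ∈ J, bprob V (1 / u ^ 24) (A L) ≤ p := by
    intro L hL
    obtain ⟨-, h1, h2, h3⟩ := Finset.mem_filter.1 hL
    exact bprob_isLineCountBad_le hu (W L) (hWV L) (fun h => hWheavy L h1 h h3)
      (fun h => hV2 L h1 h2 h)
  have hlll : ∀ K ⊆ J, ∀ L ∈ J,
      bprob V (1 / u ^ 24) (fun S => A L S ∧ ∀ j ∈ K, ¬ A j S) ≤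
        2 * p * bprob V (1 / u ^ 24) (fun S => ∀ j ∈ K, ¬ A j S) := by
    intro K hK L hL
    refine bprob_and_forall_not_le (D := ⌊2 * u ^ 36⌋₊ * d) hq0 hq1 hp0.le ?_ hAdep hAp
      (fun i hi => ⟨(W i).biUnion N, ?_, fun j hj hij => ?_⟩) K hK hL
    · have h1 : (⌊2 * u ^ 36⌋₊ : ℝ) ≤ 2 * u ^ 36 := Nat.floor_le (by positivity)
      push_cast
      calc 4 * p * (⌊2 * u ^ 36⌋₊ * d) ≤ 4 * p * (2 * u ^ 36 * (17 * u ^ 144)) := by gcongr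
        _ = 136 / 10 ^ 10 := by rw [hp]; field_simp; norm_num
        _ ≤ 1 := by norm_num
    · refine Finset.card_biUnion_le.trans ((Finset.sum_le_sum fun a _ => hNcard a).trans ?_)
      rw [Finset.sum_const, smul_eq_mul]
      exact Nat.mul_le_mul_right _ (Nat.le_floor (hWle i hi))
    · obtain ⟨a, ha, ha'⟩ := Finset.not_disjoint_iff.1 hij
      exact Finset.mem_biUnion.2 ⟨a, ha, hJN j hj a ha'⟩
  -- the global event
  set Q : Finset (Finset ℤ × Finset ℤ) :=
    (Finset.Icc (1 : ℤ) n).powerset ×ˢ (Finset.Icc (1 : ℤ) n).powerset with hQ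
  have hBad : bprob V (1 / u ^ 24)
      (fun S => ∃ z ∈ Q, IsRectCountBad n u z.1 z.2 (S ∩ R z).card) ≤
        1 / u ^ 36 * (1 - 2 * p) ^ J.card := by
    refine le_trans ?_ (rect_union_bound hu hun hJcard)
    refine (bprob_le_sum hq0 hq1 Q fun S _ h => h).trans ?_
    calc _ ≤ ∑ _z ∈ Q, 2 * Real.exp (-(100 * n)) := by
          refine Finset.sum_le_sum fun z hz => ?_
          obtain ⟨hz1, hz2⟩ := Finset.mem_product.1 hz
          rw [Finset.mem_powerset] at hz1 hz2
          refine bprob_isRectCountBad_le hn hu z.1 z.2 (R z) (hRV z) fun h1 h2 => ?_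
          have := hV4 z.1 z.2 (by rw [← Finset.coe_Icc]; exact Finset.coe_subset.2 hz1)
            (by rw [← Finset.coe_Icc]; exact Finset.coe_subset.2 hz2) h1 h2
          simpa only [mul_assoc, mul_div_assoc] using this
      _ = _ := by
          rw [Finset.sum_const, nsmul_eq_mul, hQ, Finset.card_product, Finset.card_powerset,
            Int.card_Icc]
          simp
  have h36 : (1000 : ℝ) ≤ u ^ 36 := hu.trans (le_self_pow₀ (by linarith) (by norm_num))
  obtain ⟨ν, hν, hspread⟩ := exists_pmf_avoiding (x := 2 * p) (ε := 1 / u ^ 36) (d := d)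
    hq0 hq1 (by linarith) (by linarith) (by positivity)
    (by rw [div_lt_one (by positivity)]; linarith) hAdep hlll hBad
    (fun a _ => ⟨N a, hNcard a, fun L hL ha => hJN L hL a ha⟩)
  refine ⟨ν, fun S hS => ?_, fun T hT => (hspread T hT).trans ?_⟩
  · obtain ⟨hSV, hSA, hSR⟩ := hν S hS
    refine ⟨hSV, (isNice_pow_iff hu0 _).2 ⟨?_, ?_, ?_, ?_, ?_⟩⟩
    · exact (Finset.coe_subset.2 hSV).trans hVgrid
    · intro L hL h1 h2
      have h := hSA L (hJmem L hL (by linarith) h2 (hWpos L hL (by linarith) h2))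
      rw [ncard_coe_inter_eq hSV, mul_assoc, mul_assoc]
      constructor
      · by_contra! h3
        exact h (Or.inl ⟨h1, Or.inr h3⟩)
      · by_contra! h3
        exact h (Or.inl ⟨h1, Or.inl h3⟩)
    · intro L hL h1 h2
      have h := hSA L (hJmem L hL (by linarith) (by linarith)
        (hWpos L hL (by linarith) (by linarith)))
      rw [ncard_coe_inter_eq hSV]
      by_contra! h3
      exact h (Or.inr (Or.inl ⟨h1, h2, h3⟩))
    · intro L hL h1
      rw [ncard_coe_inter_eq hSV]
      rcases le_or_gt (lineWeight n L) (1 / u ^ 72) with h2 | h2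
      · exact (Finset.card_le_card Finset.inter_subset_right).trans (hV3 L hL h2)
      · rcases (W L).eq_empty_or_nonempty with h3 | h3
        · have : S ∩ W L = ∅ := by rw [h3, Finset.inter_empty]
          exact (Finset.card_eq_zero.2 this).le.trans (by norm_num)
        · have h := hSA L (hJmem L hL h2 (by linarith) h3)
          by_contra! h4
          exact h (Or.inr (Or.inr ⟨h1, h4⟩))
    · intro I J hI hJ' h1 h2
      have hz : (I, J) ∈ Q := Finset.mem_product.2
        ⟨Finset.mem_powerset.2 (Finset.coe_subset.1 (by rw [Finset.coe_Icc]; exact hI)),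
          Finset.mem_powerset.2 (Finset.coe_subset.1 (by rw [Finset.coe_Icc]; exact hJ'))⟩
      rw [ncard_coe_inter_eq hSV]
      have e : ∀ c : ℝ, c * I.card * J.card * u ^ 12 / n =
          c * (I.card * J.card * u ^ 12 / n) := fun c => by ring
      rw [e, e]
      constructor
      · by_contra! h3
        exact hSR ⟨(I, J), hz, h1, h2, Or.inr h3⟩
      · by_contra! h3
        exact hSR ⟨(I, J), hz, h1, h2, Or.inl h3⟩
  · refine pow_le_pow_left₀ ?_ (spread_ratio_le hu hdle) _
    have h1 : 1 / u ^ 36 ≤ 1 := by rw [div_le_one (by positivity)]; linarith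
    have h2 : 0 ≤ (1 - 2 * p) ^ d := pow_nonneg (by linarith) d
    exact div_nonneg hq0 (mul_nonneg h2 (by linarith))

/-- Composing a spread distribution with a random choice of subsets. -/
theorem isSpread_bind {n : ℕ} {r s t : ℝ} (hr : 0 ≤ r) (hrst : r * s ≤ t) (hs : 0 ≤ s)
    {μ₀ : PMF (Finset (ℝ × ℝ))} (hμ₀ : IsSpread n s μ₀)
    (ν : Finset (ℝ × ℝ) → PMF (Finset (ℝ × ℝ)))
    (hν : ∀ V, μ₀ V ≠ 0 → (∀ S, ν V S ≠ 0 → S ⊆ V) ∧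
      ∀ T ⊆ V, ((ν V).toOuterMeasure {S | T ⊆ S}).toReal ≤ r ^ T.card) :
    IsSpread n t (μ₀.bind ν) := by
  classical
  intro T hT
  have htop : ∀ (μ : PMF (Finset (ℝ × ℝ))) B, μ.toOuterMeasure B ≠ ⊤ := fun μ B => by
    rw [PMF.toOuterMeasure_apply]
    exact μ.tsum_coe_indicator_ne_top B
  have h1 : (μ₀.bind ν).toOuterMeasure {S | T ⊆ S} ≤
      ENNReal.ofReal (r ^ T.card) * μ₀.toOuterMeasure {V | T ⊆ V} := by
    rw [PMF.toOuterMeasure_bind_apply, PMF.toOuterMeasure_apply, ← ENNReal.tsum_mul_left]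
    refine ENNReal.tsum_le_tsum fun V => ?_
    by_cases hV : μ₀ V = 0
    · simp [hV]
    obtain ⟨hsub, hle⟩ := hν V hV
    by_cases hTV : T ⊆ V
    · rw [Set.indicator_of_mem (by exact hTV), mul_comm]
      gcongr
      exact (ENNReal.le_ofReal_iff_toReal_le (htop _ _) (by positivity)).2 (hle T hTV)
    · have : (ν V).toOuterMeasure {S | T ⊆ S} = 0 := by
        rw [PMF.toOuterMeasure_apply_eq_zero_iff, Set.disjoint_left]
        intro S hS hTS
        exact hTV (hTS.trans (hsub S ((PMF.mem_support_iff _ _).1 hS)))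
      simp [this]
  calc _ ≤ (ENNReal.ofReal (r ^ T.card) * μ₀.toOuterMeasure {V | T ⊆ V}).toReal :=
        ENNReal.toReal_mono (ENNReal.mul_ne_top ENNReal.ofReal_ne_top (htop _ _)) h1
    _ = r ^ T.card * (μ₀.toOuterMeasure {V | T ⊆ V}).toReal := by
        rw [ENNReal.toReal_mul, ENNReal.toReal_ofReal (by positivity)]
    _ ≤ r ^ T.card * s ^ T.card := by gcongr; exact hμ₀ T hT
    _ = (r * s) ^ T.card := (mul_pow _ _ _).symm
    _ ≤ t ^ T.card := pow_le_pow_left₀ (by positivity) hrst _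

/-- induction step. If `10^36 ≤ m`, `m³ ≤ n`, and there is an
`((m³+1)/n)`-spread distribution supported on `m³`-nice subsets of `[n]²`, then there is an
`((m+1)/n)`-spread distribution supported on `m`-nice subsets of `[n]²`. -/
theorem induction_step (n : ℕ) (hn : 0 < n) (m : ℝ) (hm : 10 ^ 36 ≤ m) (hmn : m ^ 3 ≤ (n : ℝ))
    (h : ∃ μ₀ : PMF (Finset (ℝ × ℝ)),
      IsSpread n ((m ^ 3 + 1) / n) μ₀ ∧ SupportedOnNice n (m ^ 3) μ₀) :
    ∃ μ : PMF (Finset (ℝ × ℝ)),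
      IsSpread n ((m + 1) / n) μ ∧ SupportedOnNice n m μ := by
  classical
  obtain ⟨μ₀, hspread, hnice⟩ := h
  have hm0 : 0 < m := lt_of_lt_of_le (by norm_num) hm
  obtain ⟨u, hu0, rfl⟩ : ∃ u : ℝ, 0 ≤ u ∧ u ^ 12 = m :=
    ⟨m ^ ((1 : ℝ) / 12), by positivity, by
      rw [← Real.rpow_natCast, ← Real.rpow_mul hm0.le]; norm_num⟩
  have hu : 1000 ≤ u := by
    by_contra! hlt
    have := pow_lt_pow_left₀ hlt hu0 (n := 12) (by norm_num)
    norm_num at this hm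
    linarith
  have e : (u ^ 12) ^ 3 = u ^ 36 := by ring
  rw [e] at hspread hnice hmn
  have key : ∀ V : Finset (ℝ × ℝ), ∃ ν : PMF (Finset (ℝ × ℝ)), μ₀ V ≠ 0 →
      (∀ S, ν S ≠ 0 → S ⊆ V ∧ IsNice n (u ^ 12) (S : Set (ℝ × ℝ))) ∧
      ∀ T ⊆ V, (ν.toOuterMeasure {S | T ⊆ S}).toReal ≤
        ((u ^ 12 + 1) / (u ^ 36 + 1)) ^ T.card := by
    intro V
    by_cases hV : μ₀ V = 0
    · exact ⟨PMF.pure ∅, fun h => absurd hV h⟩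
    · obtain ⟨ν, hν⟩ := exists_pmf_nice_subsets hn hu hmn (hnice V hV)
      exact ⟨ν, fun _ => hν⟩
  choose ν hν using key
  refine ⟨μ₀.bind ν, isSpread_bind (r := (u ^ 12 + 1) / (u ^ 36 + 1)) (by positivity) ?_
    (by positivity) hspread ν fun V hV =>
      ⟨fun S hS => ((hν V hV).1 S hS).1, (hν V hV).2⟩, fun S hS => ?_⟩
  · exact (div_mul_div_cancel₀ (by positivity)).le
  · obtain ⟨V, hV, hS'⟩ := (PMF.mem_support_bind_iff _ _ _).1 ((PMF.mem_support_iff _ _).2 hS)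
    exact ((hν V ((PMF.mem_support_iff _ _).1 hV)).1 S ((PMF.mem_support_iff _ _).1 hS')).2
end
end
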